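/- arXiv:1510.08724 — 2 statements merged into one kernel-verified Lean document; each statement's English description precedes it below -/
import Mathlib

section
/- Let p be an odd prime, n ≥ 1, and let the cyclic group Z/p act on the unit sphere S^n ⊆ ℝ^{n+1} by orthogonal transformations (i.e. the generator acts as a linear isometry of order dividing p). Then the effective topological complexity of S^n is TC^{Z/p,∞}(S^n) = 2 if n is odd, and TC^{Z/p,∞}(S^n) = 3 if n is even. -/
open Set

/-- The space of `k`-tuples of paths in `X` that are consecutive up to the `G`-action:
the `(i+1)`-st path starts in the `G`-orbit of the endpoint of the `i`-th path. -/
def effPk (G X : Type*) [Group G] [TopologicalSpace X] [MulAction G X] (k : ℕ) :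
    Set (Fin k → C(unitInterval, X)) :=
  {γ | ∀ (i : ℕ) (h : i + 1 < k),
    γ ⟨i + 1, h⟩ 0 ∈ MulAction.orbit G (γ ⟨i, Nat.lt_of_succ_lt h⟩ 1)}

/-- A `(G,k)`-motion planner on `U ⊆ X × X`: a continuous section over `U` of the map
`π_k` sending a `k`-tuple of consecutive-up-to-`G` paths to its (start, end) pair. -/
def IsEffPlanner (G X : Type*) [Group G] [TopologicalSpace X] [MulAction G X]
    (k : ℕ) (hk : 0 < k) (U : Set (X × X)) : Prop :=
  ∃ s : U → (Fin k → C(unitInterval, X)),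
    Continuous s ∧ (∀ u, s u ∈ effPk G X k) ∧
    ∀ u : U, (s u ⟨0, hk⟩) 0 = (u : X × X).1 ∧
      (s u ⟨k - 1, Nat.sub_lt hk Nat.one_pos⟩) 1 = (u : X × X).2

/-- `TC^{G,k}(X)`: the least `ℓ ≥ 1` such that `X × X` admits an open cover by `ℓ` sets,
each admitting a `(G,k)`-motion planner; `∞` if there is no such `ℓ`. -/
noncomputable def effTC (G X : Type*) [Group G] [TopologicalSpace X] [MulAction G X]
    (k : ℕ) (hk : 0 < k) : ℕ∞ :=
  sInf {ℓ : ℕ∞ | ∃ n : ℕ, ℓ = n ∧ 1 ≤ n ∧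
    ∃ U : Fin n → Set (X × X), (∀ i, IsOpen (U i)) ∧ (⋃ i, U i) = Set.univ ∧
      ∀ i, IsEffPlanner G X k hk (U i)}

/-- Effective topological complexity `TC^{G,∞}(X)`: the minimum of `TC^{G,k}(X)` over `k ≥ 1`. -/
noncomputable def effTCinf (G X : Type*) [Group G] [TopologicalSpace X] [MulAction G X] : ℕ∞ :=
  ⨅ k : ℕ, effTC G X (k + 1) k.succ_pos

/-- Farber's (non-reduced) topological complexity `TC(X)`. -/
noncomputable def farberTC (X : Type*) [TopologicalSpace X] : ℕ∞ :=
  sInf {ℓ : ℕ∞ | ∃ n : ℕ, ℓ = n ∧ 1 ≤ n ∧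
    ∃ U : Fin n → Set (X × X), (∀ i, IsOpen (U i)) ∧ (⋃ i, U i) = Set.univ ∧
      ∀ i, ∃ s : (U i) → C(unitInterval, X), Continuous s ∧
        ∀ u : (U i), (s u) 0 = (u : X × X).1 ∧ (s u) 1 = (u : X × X).2}


namespace EffSphere
open MeasureTheory Topology

/-- The determinant form. -/
noncomputable def volForm (N : ℕ) : (Fin N → ℝ) [⋀^Fin N]→L[ℝ] ℝ :=
  { (Pi.basisFun ℝ (Fin N)).det with
    cont := by
      have h : Continuous (fun v : Fin N → Fin N → ℝ => (Pi.basisFun ℝ (Fin N)).det v) := by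
        simp only [Pi.basisFun_det_apply]
        exact Continuous.matrix_det continuous_id
      exact h }

lemma volForm_apply (N : ℕ) (v : Fin N → Fin N → ℝ) :
    volForm N v = (Pi.basisFun ℝ (Fin N)).det v := rfl

lemma volForm_comp (N : ℕ) (A : (Fin N → ℝ) →L[ℝ] (Fin N → ℝ)) :
    volForm N (fun j => A (Pi.single j 1)) = A.det := by
  rw [volForm_apply]
  have := (Pi.basisFun ℝ (Fin N)).det_comp (A : (Fin N → ℝ) →ₗ[ℝ] (Fin N → ℝ))
    (Pi.basisFun ℝ (Fin N))
  rw [Module.Basis.det_self, mul_one] at this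
  convert this using 2
  ext j
  simp

/-- The pulled back form, extended by zero. -/
noncomputable def pullForm (N : ℕ) (Ω : Set (Fin N → ℝ)) (ρ : (Fin N → ℝ) → ℝ)
    (G : (Fin (N+1) → ℝ) → (Fin N → ℝ)) (z : Fin (N+1) → ℝ) :
    (Fin (N+1) → ℝ) [⋀^Fin N]→L[ℝ] ℝ := by
  classical
  exact if Fin.tail z ∈ Ω then
    (ρ (G z) • volForm N).compContinuousLinearMap (fderiv ℝ G z) else 0

lemma continuous_tail (N : ℕ) :
    Continuous (fun z : Fin (N+1) → ℝ => (Fin.tail z : Fin N → ℝ)) := by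
  unfold Fin.tail
  fun_prop

lemma pullForm_spec {N : ℕ} {Ω K : Set (Fin N → ℝ)} (hΩ : IsOpen Ω) (hK : IsCompact K)
    {ρ : (Fin N → ℝ) → ℝ} (hρ : ContDiff ℝ 2 ρ)
    {G : (Fin (N+1) → ℝ) → (Fin N → ℝ)}
    (hG : ∀ z : Fin (N+1) → ℝ, Fin.tail z ∈ Ω → ContDiffAt ℝ 2 G z)
    (hs : ∀ z : Fin (N+1) → ℝ, Fin.tail z ∈ Ω → ρ (G z) ≠ 0 → Fin.tail z ∈ K) (hKΩ : K ⊆ Ω) (z) :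
    DifferentiableAt ℝ (pullForm N Ω ρ G) z ∧ extDeriv (pullForm N Ω ρ G) z = 0 := by
  by_cases hz : Fin.tail z ∈ Ω
  · have h1 : pullForm N Ω ρ G =ᶠ[𝓝 z]
        fun z => ((fun y => ρ y • volForm N) (G z)).compContinuousLinearMap (fderiv ℝ G z) := by
      filter_upwards [(hΩ.preimage (continuous_tail N)).mem_nhds hz] with y hy
      have hy : Fin.tail y ∈ Ω := hy
      simp [pullForm, hy]
    have hd : DifferentiableAt ℝ (fun y => ρ y • volForm N) (G z) :=
      ((hρ.differentiable (by norm_num)) _).smul_const _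
    constructor
    · refine DifferentiableAt.congr_of_eventuallyEq ?_ h1
      have hG1 := hG z hz
      have : DifferentiableAt ℝ (fderiv ℝ G) z :=
        (hG1.fderiv_right (m := 1) (by norm_num)).differentiableAt (by norm_num)
      have h2 : DifferentiableAt ℝ (fun z => (fun y => ρ y • volForm N) (G z)) z :=
        hd.comp z (hG1.differentiableAt (by norm_num))
      exact h2.continuousAlternatingMapCompContinuousLinearMap this
    · rw [h1.extDeriv_eq, extDeriv_pullback hd (hG z hz) (by simp)]
      have : extDeriv (fun y => ρ y • volForm N) (G z) = 0 := by
        ext v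
        apply AlternatingMap.map_linearDependent
          (extDeriv (fun y => ρ y • volForm N) (G z)).toAlternatingMap
        intro h
        have := h.fintype_card_le_finrank
        simp at this
      rw [this]
      ext v
      simp
  · have hz' : Fin.tail z ∉ K := fun h => hz (hKΩ h)
    have h1 : pullForm N Ω ρ G =ᶠ[𝓝 z] fun _ => 0 := by
      filter_upwards [(hK.isClosed.isOpen_compl.preimage (continuous_tail N)).mem_nhds hz'] with y hy
      have hy : Fin.tail y ∉ K := hy
      unfold pullForm
      split_ifs with h
      · have : ρ (G y) = 0 := by
          by_contra h3
          exact hy (hs y h h3)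
        rw [this]; ext v; simp
      · rfl
    refine ⟨(differentiableAt_const _).congr_of_eventuallyEq h1, ?_⟩
    rw [h1.extDeriv_eq]
    ext v
    simp [extDeriv, ContinuousAlternatingMap.alternatizeUncurryFin_apply]

lemma pullForm_zero {N : ℕ} {Ω K : Set (Fin N → ℝ)}
    {ρ : (Fin N → ℝ) → ℝ} {G : (Fin (N+1) → ℝ) → (Fin N → ℝ)}
    (hs : ∀ z : Fin (N+1) → ℝ, Fin.tail z ∈ Ω → ρ (G z) ≠ 0 → Fin.tail z ∈ K) (z : Fin (N+1) → ℝ) (hz : Fin.tail z ∉ K) :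
    pullForm N Ω ρ G z = 0 := by
  unfold pullForm
  split_ifs with h
  · have : ρ (G z) = 0 := by
      by_contra h3
      exact hz (hs z h h3)
    rw [this]; ext v; simp
  · rfl

/-- Integrand for the degree. -/
noncomputable def degInt {N : ℕ} (Ω : Set (Fin N → ℝ)) (ρ : (Fin N → ℝ) → ℝ)
    (f : (Fin N → ℝ) → (Fin N → ℝ)) : (Fin N → ℝ) → ℝ :=
  Ω.indicator (fun x => ρ (f x) * (fderiv ℝ f x).det)

lemma hasFDerivAt_cons {N : ℕ} (t : ℝ) (x : Fin N → ℝ) :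
    HasFDerivAt (fun x : Fin N → ℝ => (Fin.cons t x : Fin (N+1) → ℝ))
      (ContinuousLinearMap.pi (fun i => Fin.cases 0 (fun j => ContinuousLinearMap.proj (R := ℝ) (φ := fun _ : Fin N => ℝ) j) i)) x := by
  rw [hasFDerivAt_pi]
  intro i
  refine Fin.cases ?_ (fun j => ?_) i
  · simpa using hasFDerivAt_const t x
  · simpa using hasFDerivAt_apply j x

lemma pullForm_face {N : ℕ} {Ω : Set (Fin N → ℝ)}
    {ρ : (Fin N → ℝ) → ℝ} {G : (Fin (N+1) → ℝ) → (Fin N → ℝ)}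
    (hG : ∀ z : Fin (N+1) → ℝ, Fin.tail z ∈ Ω → ContDiffAt ℝ 2 G z) (t : ℝ) (x : Fin N → ℝ) :
    pullForm N Ω ρ G (Fin.cons t x)
      (Fin.removeNth 0 (fun i => (Pi.single i 1 : Fin (N+1) → ℝ))) =
      degInt Ω ρ (fun x => G (Fin.cons t x)) x := by
  unfold pullForm degInt
  by_cases hx : x ∈ Ω
  · simp only [Fin.tail_cons, hx, if_true, indicator_of_mem]
    have h1 : HasFDerivAt (fun x => G (Fin.cons t x)) _ x :=
      ((hG (Fin.cons t x) (by simpa using hx)).differentiableAt (by norm_num)).hasFDerivAt.comp x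
        (hasFDerivAt_cons t x)
    rw [h1.fderiv, ← volForm_comp]
    simp only [ContinuousAlternatingMap.compContinuousLinearMap_apply,
      ContinuousAlternatingMap.smul_apply, smul_eq_mul]
    congr 1
    refine congrArg (volForm N) ?_
    funext j
    simp only [Function.comp, ContinuousLinearMap.comp_apply]
    congr 1
    ext i
    refine Fin.cases ?_ (fun i => ?_) i
    · simp [Fin.removeNth]
    · simp [Fin.removeNth, Pi.single_apply]
  · simp [hx]

theorem degInt_homotopy {N : ℕ} {Ω K : Set (Fin N → ℝ)} (hΩ : IsOpen Ω) (hK : IsCompact K)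
    (hKΩ : K ⊆ Ω) {ρ : (Fin N → ℝ) → ℝ} (hρ : ContDiff ℝ 2 ρ)
    {G : (Fin (N+1) → ℝ) → (Fin N → ℝ)}
    (hG : ∀ z : Fin (N+1) → ℝ, Fin.tail z ∈ Ω → ContDiffAt ℝ 2 G z)
    (hs : ∀ z : Fin (N+1) → ℝ, Fin.tail z ∈ Ω → ρ (G z) ≠ 0 → Fin.tail z ∈ K) :
    ∫ x, degInt Ω ρ (fun x => G (Fin.cons 0 x)) x =
      ∫ x, degInt Ω ρ (fun x => G (Fin.cons 1 x)) x := by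
  obtain ⟨R, hR0, hR⟩ : ∃ R : ℝ, 0 < R ∧ ∀ x ∈ K, ∀ i, |x i| < R := by
    obtain ⟨R, hR⟩ := hK.isBounded.exists_norm_le
    refine ⟨|R| + 1, by positivity, fun x hx i => ?_⟩
    have h1 := norm_le_pi_norm x i
    have h2 := hR x hx
    rw [Real.norm_eq_abs] at h1
    linarith [le_abs_self R]
  set a : Fin (N+1) → ℝ := Fin.cons 0 (fun _ => -R)
  set b : Fin (N+1) → ℝ := Fin.cons 1 (fun _ => R)
  have hab : a ≤ b := by
    intro i
    refine Fin.cases ?_ (fun j => ?_) i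
    · simp [a, b]
    · simp [a, b]; linarith
  set ω := pullForm N Ω ρ G
  set e : Fin (N+1) → (Fin (N+1) → ℝ) := fun i => Pi.single i 1
  have hω := pullForm_spec hΩ hK hρ hG hs hKΩ
  have hdi : ∀ (i : Fin (N+1)) z, DifferentiableAt ℝ (fun z => ω z (i.removeNth e)) z := by
    intro i z
    exact (hω z).1.continuousAlternatingMap_apply_const _
  have key := integral_divergence_of_hasFDerivAt_off_countable' a b hab
    (fun i z => (-1 : ℝ) ^ (i : ℕ) * ω z (i.removeNth e))
    (fun i z => (-1 : ℝ) ^ (i : ℕ) • fderiv ℝ (fun z => ω z (i.removeNth e)) z) ∅ countable_empty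
    (fun i => by
      apply Continuous.continuousOn
      exact continuous_const.mul (continuous_iff_continuousAt.2 fun z => (hdi i z).continuousAt))
    (fun z _ i => (hdi i z).hasFDerivAt.const_mul _)
    (by
      have : (fun x => ∑ i : Fin (N+1), ((-1 : ℝ) ^ (i : ℕ) • fderiv ℝ (fun z => ω z (i.removeNth e)) x)
          (Pi.single i 1)) = fun _ => 0 := by
        ext z
        have := extDeriv_apply (hω z).1 e
        rw [(hω z).2] at this
        simpa [e] using this.symm
      rw [this]
      exact integrableOn_zero)
  have hz : ∀ x, ∑ i : Fin (N+1), ((-1 : ℝ) ^ (i : ℕ) • fderiv ℝ (fun z => ω z (i.removeNth e)) x)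
          (Pi.single i 1) = 0 := by
    intro z
    have := extDeriv_apply (hω z).1 e
    rw [(hω z).2] at this
    simpa [e] using this.symm
  simp only [hz, integral_zero] at key
  rw [Fin.sum_univ_succ] at key
  have h0 : ∀ j : Fin N, ∀ s : ℝ, |s| = R → ∀ x, ω (Fin.insertNth j.succ s x) = 0 := by
    intro j s hs' x
    apply pullForm_zero hs
    intro hx
    have := hR _ hx j
    simp [Fin.tail, hs'] at this
  have e1 : ∀ j : Fin N, b j.succ = R := fun j => by simp [b]
  have e2 : ∀ j : Fin N, a j.succ = -R := fun j => by simp [a]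
  have hRa : |R| = R := abs_of_pos hR0
  have hRb : |-R| = R := by rw [abs_neg, hRa]
  simp only [e1, e2, h0 _ _ hRa, h0 _ _ hRb] at key
  simp only [sub_self, Finset.sum_const_zero, cast_eq, add_zero, Fin.val_zero, pow_zero, one_mul, Fin.insertNth_zero] at key
  have e3 : b 0 = 1 := rfl
  have e4 : a 0 = 0 := rfl
  rw [e3, e4] at key
  have hf : ∀ t x, ω (Fin.cons t x) (Fin.removeNth 0 e) =
      degInt Ω ρ (fun x => G (Fin.cons t x)) x := fun t x => pullForm_face hG t x
  simp only [hf] at key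
  have hset : ∀ t, ∫ x in Icc (a ∘ Fin.succ) (b ∘ Fin.succ),
      degInt Ω ρ (fun x => G (Fin.cons t x)) x = ∫ x, degInt Ω ρ (fun x => G (Fin.cons t x)) x := by
    intro t
    apply setIntegral_eq_integral_of_forall_compl_eq_zero
    intro x hx
    rw [← hf]
    have : ω (Fin.cons t x) = 0 := by
      apply pullForm_zero hs
      intro hxK
      rw [Fin.tail_cons] at hxK
      apply hx
      rw [mem_Icc]
      exact ⟨fun i => by simpa [a] using (abs_lt.1 (hR x hxK i)).1.le,
        fun i => by simpa [b] using (abs_lt.1 (hR x hxK i)).2.le⟩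
    rw [this]; rfl
  have e5 : (a ∘ Fin.succAbove 0) = a ∘ Fin.succ := by simp
  have e6 : (b ∘ Fin.succAbove 0) = b ∘ Fin.succ := by simp
  rw [e5, e6, hset, hset] at key
  linarith

end EffSphere

namespace EffSphere
open MeasureTheory Topology

/-- Smooth approximation on compact sets. -/
lemma smooth_approx {M : ℕ} {X : Set (Fin M → ℝ)} (hX : IsCompact X) {f : (Fin M → ℝ) → ℝ}
    (hf : ContinuousOn f X) {ε : ℝ} (hε : 0 < ε) :
    ∃ g : (Fin M → ℝ) → ℝ, ContDiff ℝ 2 g ∧ ∀ x ∈ X, |g x - f x| < ε := by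
  have : CompactSpace X := isCompact_iff_compactSpace.1 hX
  let A : Subalgebra ℝ C(X, ℝ) :=
    { carrier := {h | ∃ g : (Fin M → ℝ) → ℝ, ContDiff ℝ 2 g ∧ ∀ x : X, h x = g x}
      mul_mem' := by
        rintro a b ⟨g, hg, h⟩ ⟨g', hg', h'⟩
        exact ⟨fun x => g x * g' x, hg.mul hg', fun x => by simp [h, h']⟩
      add_mem' := by
        rintro a b ⟨g, hg, h⟩ ⟨g', hg', h'⟩
        exact ⟨fun x => g x + g' x, hg.add hg', fun x => by simp [h, h']⟩
      algebraMap_mem' := by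
        intro r
        exact ⟨fun _ => r, contDiff_const, fun x => by simp⟩ }
  have hA : A.SeparatesPoints := by
    intro x y hxy
    obtain ⟨i, hi⟩ : ∃ i, (x : Fin M → ℝ) i ≠ (y : Fin M → ℝ) i := by
      by_contra! h
      exact hxy (Subtype.ext (funext h))
    let h : C(X, ℝ) := ⟨fun x => (x : Fin M → ℝ) i, (continuous_apply i).comp continuous_subtype_val⟩
    refine ⟨h, ⟨h, ⟨fun x => x i, contDiff_apply ℝ ℝ i, fun x => rfl⟩, rfl⟩, hi⟩
  let F : C(X, ℝ) := ⟨fun x => f x, continuousOn_iff_continuous_domRestrict.1 hf⟩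
  obtain ⟨⟨h, g, hg, hgh⟩, hh⟩ :=
    ContinuousMap.exists_mem_subalgebra_near_continuousMap_of_separatesPoints A hA F ε hε
  refine ⟨g, hg, fun x hx => ?_⟩
  have := (ContinuousMap.norm_lt_iff _ hε).1 hh ⟨x, hx⟩
  change |h ⟨x, hx⟩ - f x| < ε at this
  rwa [hgh] at this

theorem no_homotopy_pi {N : ℕ} {Ω : Set (Fin N → ℝ)} (hΩ : IsOpen Ω)
    (hbd : Bornology.IsBounded Ω)
    (Φ : ℝ → (Fin N → ℝ) → (Fin N → ℝ))
    (hc : ContinuousOn (Function.uncurry Φ) (Icc (0:ℝ) 1 ×ˢ closure Ω))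
    (hb : ∀ t ∈ Icc (0:ℝ) 1, ∀ x ∈ closure Ω, x ∉ Ω → Φ t x ≠ 0)
    (h1 : ∀ x ∈ closure Ω, Φ 1 x ≠ 0)
    (hsm : ∀ x ∈ Ω, ContDiffAt ℝ 2 (Φ 0) x) (σ : ℝ)
    (hdet : ∀ x ∈ Ω, Φ 0 x = 0 → 0 < σ * (fderiv ℝ (Φ 0) x).det) :
    ∀ x ∈ Ω, Φ 0 x ≠ 0 := by
  intro x₀ hx₀ hzero
  have hC : IsCompact (closure Ω) := hbd.isCompact_closure
  have hIC : IsCompact (Icc (0:ℝ) 1 ×ˢ closure Ω) := isCompact_Icc.prod hC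
  have hdc : ∀ x ∈ Ω, ContinuousAt (fun x => (fderiv ℝ (Φ 0) x).det) x := by
    intro x hx
    have h2 : ContinuousAt (fderiv ℝ (Φ 0)) x :=
      ((hsm x hx).fderiv_right (m := 1) (by norm_num)).continuousAt
    exact (ContinuousLinearMap.continuous_det.continuousAt).comp h2
  have hO : IsOpen {x | x ∈ Ω ∧ 0 < σ * (fderiv ℝ (Φ 0) x).det} := by
    rw [isOpen_iff_mem_nhds]
    rintro x ⟨hx, hx'⟩
    have := ((continuousAt_const (y := σ)).mul (hdc x hx)).eventually (lt_mem_nhds hx')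
    filter_upwards [hΩ.mem_nhds hx, this] with y h1 h2 using ⟨h1, h2⟩
  set D := closure Ω \ {x | x ∈ Ω ∧ 0 < σ * (fderiv ℝ (Φ 0) x).det}
  have hD : IsCompact D := hC.diff hO
  set B : Set (ℝ × (Fin N → ℝ)) :=
    (Icc (0:ℝ) 1 ×ˢ (closure Ω \ Ω)) ∪ (({1} ×ˢ closure Ω) ∪ ({0} ×ˢ D))
  have hB : IsCompact B :=
    (isCompact_Icc.prod (hC.diff hΩ)).union
      ((isCompact_singleton.prod hC).union (isCompact_singleton.prod hD))
  have hBsub : B ⊆ Icc (0:ℝ) 1 ×ˢ closure Ω := by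
    rintro ⟨t, x⟩ (⟨ht, hx⟩ | ⟨ht, hx⟩ | ⟨ht, hx⟩)
    · exact ⟨ht, hx.1⟩
    · simp only [mem_singleton_iff] at ht
      exact ⟨by simp [ht], hx⟩
    · simp only [mem_singleton_iff] at ht
      exact ⟨by simp [ht], hx.1⟩
  obtain ⟨c, hc0, hcB⟩ : ∃ c : ℝ, 0 < c ∧ ∀ z ∈ B, c ≤ ‖Function.uncurry Φ z‖ := by
    apply hB.exists_forall_le' (hc.mono hBsub).norm
    rintro ⟨t, x⟩ (⟨ht, hx⟩ | ⟨ht, hx⟩ | ⟨ht, hx⟩)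
    · exact norm_pos_iff.2 (hb t ht x hx.1 hx.2)
    · simp only [mem_singleton_iff] at ht
      subst ht
      exact norm_pos_iff.2 (h1 x hx)
    · simp only [mem_singleton_iff] at ht
      subst ht
      apply norm_pos_iff.2
      intro h
      by_cases hxO : x ∈ Ω
      · exact hx.2 ⟨hxO, hdet x hxO h⟩
      · exact hb 0 (by simp) x hx.1 hxO h
  set K : Set (Fin N → ℝ) := Prod.snd '' ((Icc (0:ℝ) 1 ×ˢ closure Ω) ∩
    (fun z => ‖Function.uncurry Φ z‖) ⁻¹' (Iic (c/2)))
  have hK : IsCompact K := by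
    apply IsCompact.image _ continuous_snd
    exact hIC.of_isClosed_subset
      (hc.norm.preimage_isClosed_of_isClosed hIC.isClosed isClosed_Iic) inter_subset_left
  have hKmem : ∀ t ∈ Icc (0:ℝ) 1, ∀ x ∈ closure Ω, ‖Φ t x‖ ≤ c/2 → x ∈ K := by
    intro t ht x hx h
    exact ⟨(t, x), ⟨⟨ht, hx⟩, h⟩, rfl⟩
  have hKΩ : K ⊆ Ω := by
    rintro x ⟨⟨t, y⟩, ⟨⟨ht, hy⟩, h⟩, rfl⟩
    by_contra hyO
    have := hcB (t, y) (Or.inl ⟨ht, hy, hyO⟩)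
    simp only [mem_preimage, mem_Iic] at h
    linarith
  -- smooth approximation
  obtain ⟨P, hP, hPΦ⟩ : ∃ P : (Fin (N+1) → ℝ) → (Fin N → ℝ), ContDiff ℝ 2 P ∧
      ∀ t ∈ Icc (0:ℝ) 1, ∀ x ∈ closure Ω, ‖P (Fin.cons t x) - Φ t x‖ < c / 8 := by
    set X : Set (Fin (N+1) → ℝ) :=
      (fun p : ℝ × (Fin N → ℝ) => (Fin.cons p.1 p.2 : Fin (N+1) → ℝ)) ''
        (Icc (0:ℝ) 1 ×ˢ closure Ω)
    have hconsc : Continuous (fun p : ℝ × (Fin N → ℝ) => (Fin.cons p.1 p.2 : Fin (N+1) → ℝ)) := by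
      refine continuous_pi fun i => ?_
      refine Fin.cases ?_ (fun j => ?_) i
      · simpa using continuous_fst
      · simp only [Fin.cons_succ]; fun_prop
    have hX : IsCompact X := hIC.image hconsc
    have : ∀ j : Fin N, ∃ g : (Fin (N+1) → ℝ) → ℝ, ContDiff ℝ 2 g ∧
        ∀ z ∈ X, |g z - Φ (z 0) (Fin.tail z) j| < c / 8 := by
      intro j
      apply smooth_approx hX _ (by positivity)
      have h2 : ContinuousOn (fun z : Fin (N+1) → ℝ =>
          Function.uncurry Φ (z 0, Fin.tail z)) X := by
        apply hc.comp
        · exact ((continuous_apply 0).prodMk (continuous_tail N)).continuousOn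
        · rintro _ ⟨⟨t, x⟩, h, rfl⟩
          simpa using h
      exact (continuous_apply j).comp_continuousOn h2
    choose g hg hgX using this
    refine ⟨fun z j => g j z, contDiff_pi.2 hg, fun t ht x hx => ?_⟩
    rw [pi_norm_lt_iff (by positivity)]
    intro j
    have := hgX j (Fin.cons t x) ⟨(t, x), ⟨ht, hx⟩, rfl⟩
    simpa using this
  let β : ContDiffBump (0 : Fin N → ℝ) := ⟨c/16, c/4, by positivity, by linarith⟩
  have hβ : ContDiff ℝ 2 β := β.contDiff
  have hβs : ∀ y, β y ≠ 0 → ‖y‖ < c / 4 := by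
    intro y hy
    have : y ∈ Function.support β := hy
    rw [β.support_eq] at this
    simpa [β] using this
  have hτ : ∀ t, Real.smoothTransition t ∈ Icc (0:ℝ) 1 := fun t =>
    ⟨Real.smoothTransition.nonneg t, Real.smoothTransition.le_one t⟩
  have hτc : ContDiff ℝ 2 (fun z : Fin (N+1) → ℝ => Real.smoothTransition (z 0)) :=
    Real.smoothTransition.contDiff.comp (contDiff_apply ℝ ℝ 0)
  have htc : ContDiff ℝ 2 (fun z : Fin (N+1) → ℝ => (Fin.tail z : Fin N → ℝ)) := by
    rw [contDiff_pi]
    intro j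
    exact contDiff_apply ℝ ℝ j.succ
  have hcons : ∀ f : (Fin (N+1) → ℝ) → ℝ, ContDiff ℝ 2 f →
      ContDiff ℝ 2 (fun z : Fin (N+1) → ℝ => (Fin.cons (f z) (Fin.tail z) : Fin (N+1) → ℝ)) := by
    intro f hf
    rw [contDiff_pi]
    intro i
    refine Fin.cases ?_ (fun j => ?_) i
    · simpa using hf
    · simp only [Fin.cons_succ]
      exact contDiff_apply ℝ ℝ j.succ
  -- step 1
  have s1 := degInt_homotopy (G := fun z => P (Fin.cons (Real.smoothTransition (z 0)) (Fin.tail z)))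
    hΩ hK hKΩ hβ
    (fun z _ => (hP.comp (hcons _ hτc)).contDiffAt)
    (fun z hz h => by
      have h2 := hβs _ h
      have h3 := hPΦ _ (hτ (z 0)) _ (subset_closure hz)
      apply hKmem _ (hτ (z 0)) _ (subset_closure hz)
      have := norm_sub_norm_le (Φ (Real.smoothTransition (z 0)) (Fin.tail z))
        (P (Fin.cons (Real.smoothTransition (z 0)) (Fin.tail z)))
      rw [norm_sub_rev] at this
      linarith)
  -- step 2
  have s2 := degInt_homotopy (G := fun z => Φ 0 (Fin.tail z) + Real.smoothTransition (z 0) •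
      (P (Fin.cons 0 (Fin.tail z)) - Φ 0 (Fin.tail z)))
    hΩ hK hKΩ hβ
    (fun z hz => by
      have h2 : ContDiffAt ℝ 2 (fun z : Fin (N+1) → ℝ => Φ 0 (Fin.tail z)) z :=
        ContDiffAt.comp z (hsm _ hz) htc.contDiffAt
      exact h2.add (hτc.contDiffAt.smul ((hP.comp (hcons _ contDiff_const)).contDiffAt.sub h2)))
    (fun z hz h => by
      have h2 := hβs _ h
      have h3 := hPΦ 0 (by simp) _ (subset_closure hz)
      apply hKmem 0 (by simp) _ (subset_closure hz)
      have h4 := norm_sub_norm_le (Φ 0 (Fin.tail z)) (Φ 0 (Fin.tail z) +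
        Real.smoothTransition (z 0) • (P (Fin.cons 0 (Fin.tail z)) - Φ 0 (Fin.tail z)))
      have h5 : ‖Φ 0 (Fin.tail z) - (Φ 0 (Fin.tail z) +
        Real.smoothTransition (z 0) • (P (Fin.cons 0 (Fin.tail z)) - Φ 0 (Fin.tail z)))‖ ≤ c/8 := by
        rw [sub_add_cancel_left, norm_neg, norm_smul, Real.norm_eq_abs,
          abs_of_nonneg (hτ (z 0)).1]
        calc _ ≤ 1 * ‖(P (Fin.cons 0 (Fin.tail z)) - Φ 0 (Fin.tail z))‖ := by
              gcongr; exact (hτ (z 0)).2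
          _ ≤ c/8 := by rw [one_mul]; exact h3.le
      linarith)
  simp only [Fin.cons_zero, Fin.tail_cons, Real.smoothTransition.zero, Real.smoothTransition.one,
    zero_smul, add_zero, one_smul, add_sub_cancel] at s1 s2
  have s3 : degInt Ω β (fun x => P (Fin.cons 1 x)) = fun _ => 0 := by
    ext x
    unfold degInt
    by_cases hx : x ∈ Ω
    · rw [indicator_of_mem hx]
      have : β (P (Fin.cons 1 x)) = 0 := by
        by_contra h
        have h2 := hβs _ h
        have h3 := hPΦ 1 (by simp) _ (subset_closure hx)
        have h4 := hcB (1, x) (Or.inr (Or.inl ⟨rfl, subset_closure hx⟩))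
        have := norm_sub_norm_le (Φ 1 x) (P (Fin.cons 1 x))
        rw [norm_sub_rev] at this
        simp only [Function.uncurry_apply_pair] at h4
        linarith
      rw [this, zero_mul]
    · rw [indicator_of_notMem hx]
  rw [s1, s3, integral_zero] at s2
  -- positivity
  have hz0 : ∀ x, x ∉ K → degInt Ω β (Φ 0) x = 0 := by
    intro x hxK
    unfold degInt
    by_cases hx : x ∈ Ω
    · rw [indicator_of_mem hx]
      have : β (Φ 0 x) = 0 := by
        by_contra h
        apply hxK
        apply hKmem 0 (by simp) _ (subset_closure hx)
        linarith [hβs _ h]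
      rw [this, zero_mul]
    · rw [indicator_of_notMem hx]
  have hcont : Continuous (degInt Ω β (Φ 0)) := by
    rw [continuous_iff_continuousAt]
    intro x
    by_cases hx : x ∈ Ω
    · have h2 : ContinuousAt (fun x => β (Φ 0 x) * (fderiv ℝ (Φ 0) x).det) x :=
        (β.continuous.continuousAt.comp (hsm x hx).continuousAt).mul (hdc x hx)
      apply h2.congr
      filter_upwards [hΩ.mem_nhds hx] with y hy
      simp [degInt, hy]
    · have h2 : ContinuousAt (fun _ : Fin N → ℝ => (0:ℝ)) x := continuousAt_const
      apply h2.congr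
      filter_upwards [hK.isClosed.isOpen_compl.mem_nhds (fun h => hx (hKΩ h))] with y hy
      exact (hz0 y hy).symm
  have hpos : 0 < ∫ x, σ * degInt Ω β (Φ 0) x := by
    have hcont' : Continuous (fun x => σ * degInt Ω β (Φ 0) x) := continuous_const.mul hcont
    apply hcont'.integral_pos_of_hasCompactSupport_nonneg_nonzero
      (x := x₀)
    · apply HasCompactSupport.intro hK
      intro x hx
      rw [hz0 x hx, mul_zero]
    · intro x
      show 0 ≤ σ * degInt Ω β (Φ 0) x
      by_cases hx : x ∈ Ω
      · simp only [degInt, indicator_of_mem hx]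
        by_cases h : β (Φ 0 x) = 0
        · simp [h]
        · have h2 := hβs _ h
          have : 0 < σ * (fderiv ℝ (Φ 0) x).det := by
            by_contra h3
            have := hcB (0, x) (Or.inr (Or.inr ⟨rfl, subset_closure hx, fun h4 => h3 h4.2⟩))
            simp only [Function.uncurry_apply_pair] at this
            linarith
          have h5 : 0 ≤ β (Φ 0 x) := β.nonneg
          calc (0:ℝ) ≤ β (Φ 0 x) * (σ * (fderiv ℝ (Φ 0) x).det) := by positivity
            _ = _ := by ring
      · simp [degInt, hx]
    · have h2 := hdet x₀ hx₀ hzero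
      show σ * degInt Ω β (Φ 0) x₀ ≠ 0
      simp only [degInt, indicator_of_mem hx₀, hzero]
      have : β 0 = 1 := β.one_of_mem_closedBall (by simp [β]; positivity)
      rw [this, one_mul]
      exact h2.ne'
  rw [integral_const_mul] at hpos
  have e : (fun x => Φ 0 x) = Φ 0 := rfl
  rw [e] at s2
  rw [s2, mul_zero] at hpos
  exact lt_irrefl _ hpos

/-- The same in an arbitrary finite dimensional space. -/
theorem no_homotopy {V : Type*} [NormedAddCommGroup V] [NormedSpace ℝ V] [FiniteDimensional ℝ V]
    {Ω : Set V} (hΩ : IsOpen Ω)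
    (hbd : Bornology.IsBounded Ω)
    (Φ : ℝ → V → V)
    (hc : ContinuousOn (Function.uncurry Φ) (Icc (0:ℝ) 1 ×ˢ closure Ω))
    (hb : ∀ t ∈ Icc (0:ℝ) 1, ∀ x ∈ closure Ω, x ∉ Ω → Φ t x ≠ 0)
    (h1 : ∀ x ∈ closure Ω, Φ 1 x ≠ 0)
    (hsm : ∀ x ∈ Ω, ContDiffAt ℝ 2 (Φ 0) x) (σ : ℝ)
    (hdet : ∀ x ∈ Ω, Φ 0 x = 0 → 0 < σ * (fderiv ℝ (Φ 0) x).det) :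
    ∀ x ∈ Ω, Φ 0 x ≠ 0 := by
  let N := Module.finrank ℝ V
  let E : V ≃L[ℝ] (Fin N → ℝ) := ContinuousLinearEquiv.ofFinrankEq (by simp [N])
  have hcl : closure (E.symm ⁻¹' Ω) = E.symm ⁻¹' (closure Ω) :=
    (E.symm.toHomeomorph.preimage_closure Ω).symm
  intro x hx
  have hfd : ∀ y, E.symm y ∈ Ω → HasFDerivAt (fun y => E (Φ 0 (E.symm y)))
      ((E : V →L[ℝ] _).comp ((fderiv ℝ (Φ 0) (E.symm y)).comp (E.symm : _ →L[ℝ] V))) y := by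
    intro y hy
    have h2 : HasFDerivAt (Φ 0) (fderiv ℝ (Φ 0) (E.symm y)) (E.symm y) :=
      ((hsm _ hy).differentiableAt (by norm_num)).hasFDerivAt
    exact E.hasFDerivAt.comp y (h2.comp y E.symm.hasFDerivAt)
  have := no_homotopy_pi (Ω := E.symm ⁻¹' Ω) (hΩ.preimage E.symm.continuous)
    (by
      rw [← ContinuousLinearEquiv.image_eq_preimage_symm]
      exact E.lipschitz.isBounded_image hbd)
    (fun t y => E (Φ t (E.symm y)))
    (by
      rw [hcl]
      apply E.continuous.comp_continuousOn
      have : ContinuousOn (fun p : ℝ × (Fin N → ℝ) => Function.uncurry Φ (p.1, E.symm p.2))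
          (Icc (0:ℝ) 1 ×ˢ (E.symm ⁻¹' closure Ω)) := by
        apply hc.comp
        · exact (continuous_fst.prodMk (E.symm.continuous.comp continuous_snd)).continuousOn
        · rintro ⟨t, y⟩ ⟨ht, hy⟩
          exact ⟨ht, hy⟩
      exact this)
    (by
      rw [hcl]
      intro t ht y hy hy' h
      exact hb t ht _ hy hy' (by simpa using h))
    (by
      rw [hcl]
      intro y hy h
      exact h1 _ hy (by simpa using h))
    (by
      intro y hy
      exact E.contDiff.contDiffAt.comp y (ContDiffAt.comp y (hsm _ hy) E.symm.contDiff.contDiffAt))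
    σ
    (by
      intro y hy h
      rw [(hfd y hy).fderiv]
      have h2 := hdet _ hy (by simpa using h)
      convert h2 using 2
      exact LinearMap.det_conj (fderiv ℝ (Φ 0) (E.symm y) : V →ₗ[ℝ] V) E.toLinearEquiv)
    (E x) (by simpa using hx)
  intro h
  apply this
  simp [h]

end EffSphere

set_option linter.unusedSectionVars false

namespace EffSphere
open MeasureTheory Topology

section Lin
variable {V : Type*} [NormedAddCommGroup V] [NormedSpace ℝ V] [FiniteDimensional ℝ V]

lemma det_pos_of_no_eig (T : V →L[ℝ] V) (h : ∀ c : ℝ, c ≤ 0 → ∀ z, T z = c • z → z = 0) :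
    0 < T.det := by
  let f : ℝ → ℝ := fun s => ((1 - s) • T + s • ContinuousLinearMap.id ℝ V).det
  have hf : Continuous f := ContinuousLinearMap.continuous_det.comp (by fun_prop)
  have hne : ∀ s ∈ Icc (0:ℝ) 1, f s ≠ 0 := by
    intro s hs h0
    have h0' : LinearMap.det
      (((1 - s) • T + s • ContinuousLinearMap.id ℝ V : V →L[ℝ] V) : V →ₗ[ℝ] V) = 0 := h0
    obtain ⟨z, hz, hz0⟩ := Submodule.exists_mem_ne_zero_of_ne_bot
      (LinearMap.bot_lt_ker_of_det_eq_zero h0').ne'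
    have hz' : (1 - s) • T z + s • z = 0 := by simpa using hz
    rcases eq_or_lt_of_le hs.2 with h1 | h1
    · subst h1
      simp at hz'
      exact hz0 hz'
    · apply hz0
      have h1s : (1 - s) ≠ 0 := by linarith
      apply h (-(s / (1 - s)))
      · have := hs.1
        have : 0 < 1 - s := by linarith
        have : 0 ≤ s / (1 - s) := div_nonneg hs.1 this.le
        linarith
      · have h2 : (1 - s) • T z = -(s • z) := eq_neg_of_add_eq_zero_left hz'
        calc T z = (1 - s)⁻¹ • ((1 - s) • T z) := by rw [smul_smul, inv_mul_cancel₀ h1s, one_smul]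
          _ = _ := by rw [h2, smul_neg, smul_smul, neg_smul]; congr 2; field_simp
  have f0 : f 0 = T.det := by simp [f]
  have f1 : f 1 = 1 := by simp [f, ContinuousLinearMap.det]
  rw [← f0]
  by_contra hneg
  obtain ⟨s, hs, hs0⟩ := intermediate_value_Icc (zero_le_one (α := ℝ)) hf.continuousOn
    (show (0:ℝ) ∈ Icc (f 0) (f 1) from ⟨not_lt.1 hneg, by rw [f1]; norm_num⟩)
  exact hne s hs hs0

lemma det_comp_clm (A B : V →L[ℝ] V) : (A.comp B).det = A.det * B.det :=
  LinearMap.det_comp (A : V →ₗ[ℝ] V) (B : V →ₗ[ℝ] V)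

lemma det_swap : LinearMap.det ((LinearEquiv.prodComm ℝ V V) : V × V →ₗ[ℝ] V × V)
    = (-1) ^ Module.finrank ℝ V := by
  let e : (V × V) ≃ₗ[ℝ] (V × V) :=
    { toFun := fun z => (z.1 + z.2, z.1 - z.2)
      invFun := fun z => ((2:ℝ)⁻¹ • (z.1 + z.2), (2:ℝ)⁻¹ • (z.1 - z.2))
      map_add' := by intro a b; ext <;> simp <;> abel
      map_smul' := by intro a b; ext <;> simp [smul_sub]
      left_inv := by
        intro z
        ext <;> simp <;> rw [← two_smul ℝ, smul_smul] <;> norm_num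
      right_inv := by
        intro z
        ext <;> simp [← smul_add, ← smul_sub]
        · rw [← two_smul ℝ, smul_smul]; norm_num
        · rw [← two_smul ℝ, smul_smul]; norm_num }
  have h := LinearMap.det_conj ((LinearEquiv.prodComm ℝ V V) : V × V →ₗ[ℝ] V × V) e
  rw [← h]
  have : (e : V × V →ₗ[ℝ] V × V) ∘ₗ ((LinearEquiv.prodComm ℝ V V) : V × V →ₗ[ℝ] V × V) ∘ₗ
      (e.symm : V × V →ₗ[ℝ] V × V) = LinearMap.prodMap LinearMap.id (-LinearMap.id) := by
    apply LinearMap.ext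
    intro z
    obtain ⟨z, rfl⟩ := e.surjective z
    show e (LinearEquiv.prodComm ℝ V V (e.symm (e z))) = _
    rw [e.symm_apply_apply]
    show (z.2 + z.1, z.2 - z.1) = (z.1 + z.2, -(z.1 - z.2))
    rw [add_comm, neg_sub]
  rw [this, LinearMap.det_prodMap, LinearMap.det_id, one_mul]
  rw [← neg_one_smul ℝ (LinearMap.id : V →ₗ[ℝ] V), LinearMap.det_smul, LinearMap.det_id, mul_one]

end Lin

section Lin2
variable {E : Type*} [NormedAddCommGroup E] [InnerProductSpace ℝ E] [FiniteDimensional ℝ E]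
local notation "⟪" x "," y "⟫" => inner ℝ x y

/-- twice the projection to `e⊥` plus `c` times the projection to `e`. -/
noncomputable def Tm (e : E) (c : ℝ) : E →L[ℝ] E :=
  (2:ℝ) • (ContinuousLinearMap.id ℝ E - (innerSL ℝ e).smulRight e) + c • (innerSL ℝ e).smulRight e

lemma Tm_apply (e : E) (c : ℝ) (v : E) :
    Tm e c v = (2:ℝ) • (v - ⟪e, v⟫ • e) + c • ⟪e, v⟫ • e := by
  simp [Tm]

lemma inner_Tm {e : E} (he : ‖e‖ = 1) (c : ℝ) (v : E) : ⟪e, Tm e c v⟫ = c * ⟪e, v⟫ := by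
  rw [Tm_apply]
  simp only [inner_add_right, inner_smul_right, inner_sub_right, real_inner_self_eq_norm_sq, he]
  ring

lemma Tm_eig {e : E} (he : ‖e‖ = 1) {c d : ℝ} (hc : 0 < c) (hd : d ≤ 0) {z : E}
    (h : Tm e c z = d • z) : z = 0 := by
  have h1 : ⟪e, z⟫ = 0 := by
    have := inner_Tm he c z
    rw [h, inner_smul_right] at this
    have : (d - c) * ⟪e, z⟫ = 0 := by linarith
    rcases mul_eq_zero.1 this with h | h
    · linarith
    · exact h
  rw [Tm_apply, h1] at h
  have : (2 - d) • z = 0 := by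
    rw [sub_smul, ← h]; simp
  rcases smul_eq_zero.1 this with h | h
  · linarith
  · exact h

lemma det_Tm_one {e : E} (he : ‖e‖ = 1) : 0 < (Tm e 1).det :=
  det_pos_of_no_eig _ fun _ hd _ h => Tm_eig he one_pos hd h

lemma det_refl {e : E} (he : ‖e‖ = 1) :
    LinearMap.det ((Submodule.reflection (ℝ ∙ e)ᗮ).toLinearEquiv : E →ₗ[ℝ] E) = -1 := by
  have h := Submodule.det_reflection (ℝ ∙ e)ᗮ
  rw [Submodule.orthogonal_orthogonal, finrank_span_singleton (by intro h; simp [h] at he)] at h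
  simpa using h

lemma det_Tm_neg_one {e : E} (he : ‖e‖ = 1) : (Tm e (-1)).det < 0 := by
  have h1 := det_Tm_one he
  have h2 : (Tm e 1 : E →ₗ[ℝ] E) =
    ((Submodule.reflection (ℝ ∙ e)ᗮ).toLinearEquiv : E →ₗ[ℝ] E) ∘ₗ (Tm e (-1) : E →ₗ[ℝ] E) := by
    ext v
    have := Submodule.reflection_orthogonalComplement_singleton_eq_neg (𝕜 := ℝ) e
    have h3 : (Submodule.reflection (ℝ ∙ e)ᗮ) (v - ⟪e, v⟫ • e) = v - ⟪e, v⟫ • e := by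
      rw [Submodule.reflection_eq_self_iff, Submodule.mem_orthogonal_singleton_iff_inner_right,
        inner_sub_right, inner_smul_right, real_inner_self_eq_norm_sq, he]
      ring
    simp only [LinearMap.coe_comp, Function.comp_apply, ContinuousLinearMap.coe_coe, Tm_apply]
    show _ = (Submodule.reflection (ℝ ∙ e)ᗮ) _
    rw [map_add, map_smul, h3, map_smul, map_smul, this]
    simp
  unfold ContinuousLinearMap.det at h1 ⊢
  rw [h2, LinearMap.det_comp, det_refl he] at h1
  linarith

/-- The derivative at the second type of zeros. -/
noncomputable def Dm (e e' : E) : E × E →L[ℝ] E × E :=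
  ContinuousLinearMap.prod
    ((Tm e 0).comp (ContinuousLinearMap.snd ℝ E E) -
      ((innerSL ℝ e').smulRight e).comp (ContinuousLinearMap.fst ℝ E E))
    ((Tm e' 0).comp (ContinuousLinearMap.fst ℝ E E) +
      ((innerSL ℝ e).smulRight e').comp (ContinuousLinearMap.snd ℝ E E))

lemma Dm_apply (e e' : E) (v w : E) :
    Dm e e' (v, w) = (Tm e 0 w - ⟪e', v⟫ • e, Tm e' 0 v + ⟪e, w⟫ • e') := by
  simp [Dm]

lemma det_Dm {e e' : E} (he : ‖e‖ = 1) (he' : ‖e'‖ = 1) (hodd : Odd (Module.finrank ℝ E)) :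
    (Dm e e').det < 0 := by
  let S : E × E →L[ℝ] E × E := ((LinearEquiv.prodComm ℝ E E) : E × E →ₗ[ℝ] E × E).toContinuousLinearMap
  have hS : S.det = -1 := by
    have : S.det = LinearMap.det ((LinearEquiv.prodComm ℝ E E) : E × E →ₗ[ℝ] E × E) := rfl
    rw [this, det_swap, hodd.neg_one_pow]
  have h : 0 < (S.comp (Dm e e')).det := by
    apply det_pos_of_no_eig
    rintro c hc ⟨v, w⟩ h
    have hSa : ∀ a b : E, S (a, b) = (b, a) := fun a b => rfl
    rw [ContinuousLinearMap.comp_apply, Dm_apply, hSa, Prod.smul_mk, Prod.mk.injEq] at h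
    obtain ⟨h1, h2⟩ := h
    have i1 := congrArg (fun z => ⟪e', z⟫) h1
    have i2 := congrArg (fun z => ⟪e, z⟫) h2
    simp only [inner_add_right, inner_sub_right, inner_smul_right, inner_Tm he, inner_Tm he',
      real_inner_self_eq_norm_sq, he, he'] at i1 i2
    have a0 : ⟪e', v⟫ = 0 := by
      have : (1 + c^2) * ⟪e', v⟫ = 0 := by
        have e1 : ⟪e, w⟫ = c * ⟪e', v⟫ := by linarith
        rw [e1] at i2
        linarith
      rcases mul_eq_zero.1 this with h | h
      · nlinarith [sq_nonneg c]
      · exact h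
    have b0 : ⟪e, w⟫ = 0 := by rw [a0] at i1; linarith
    rw [Tm_apply, a0, b0] at h1
    rw [Tm_apply, a0, b0] at h2
    simp only [zero_smul, sub_zero, smul_zero, add_zero] at h1 h2
    have k : ∀ z : E, (2:ℝ) • z = c • z → z = 0 := by
      intro z hz
      have : (2 - c) • z = 0 := by rw [sub_smul, hz, sub_self]
      rcases smul_eq_zero.1 this with h | h
      · linarith
      · exact h
    rw [k v h1, k w h2]; rfl
  rw [det_comp_clm, hS] at h
  linarith

end Lin2
end EffSphere
set_option linter.unusedSectionVars false

namespace EffSphere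
open MeasureTheory Topology

/-- radial weight -/
noncomputable def wfun (κ t : ℝ) : ℝ := 2 * Real.smoothTransition ((t - κ) / (1 - κ))

lemma wfun_contDiff (κ : ℝ) : ContDiff ℝ 2 (wfun κ) := by
  unfold wfun
  exact contDiff_const.mul (Real.smoothTransition.contDiff.comp
    ((contDiff_id.sub contDiff_const).div_const _))

lemma wfun_nonneg (κ t : ℝ) : 0 ≤ wfun κ t :=
  mul_nonneg (by norm_num) (Real.smoothTransition.nonneg _)

lemma wfun_le (κ t : ℝ) : wfun κ t ≤ 2 := by
  have := Real.smoothTransition.le_one ((t - κ) / (1 - κ))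
  unfold wfun; linarith

lemma wfun_zero {κ t : ℝ} (hκ : κ < 1) (h : t ≤ κ) : wfun κ t = 0 := by
  unfold wfun
  rw [Real.smoothTransition.zero_of_nonpos, mul_zero]
  exact div_nonpos_of_nonpos_of_nonneg (by linarith) (by linarith)

lemma wfun_pos {κ t : ℝ} (hκ : κ < 1) (h : κ < t) : 0 < wfun κ t := by
  unfold wfun
  exact mul_pos (by norm_num) (Real.smoothTransition.pos_of_pos
    (div_pos (by linarith) (by linarith)))

lemma wfun_one {κ : ℝ} (hκ : κ < 1) : wfun κ 1 = 2 := by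
  unfold wfun
  rw [div_self (by linarith), Real.smoothTransition.one, mul_one]

lemma wfun_deriv {κ : ℝ} (hκ : κ < 1) : HasDerivAt (wfun κ) 0 1 := by
  have h1 : DifferentiableAt ℝ (wfun κ) 1 :=
    (wfun_contDiff κ).differentiable (by norm_num) 1
  have h2 : IsLocalMax (wfun κ) 1 := by
    filter_upwards with t
    rw [wfun_one hκ]; exact wfun_le κ t
  have := h1.hasDerivAt
  rwa [h2.deriv_eq_zero] at this

section
variable {E : Type*} [NormedAddCommGroup E] [InnerProductSpace ℝ E] [FiniteDimensional ℝ E]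
local notation "⟪" x "," y "⟫" => inner ℝ x y

/-- normalisation -/
noncomputable def nrm (x : E) : E := ‖x‖⁻¹ • x

lemma norm_nrm {x : E} (hx : x ≠ 0) : ‖nrm x‖ = 1 := by
  rw [nrm, norm_smul, norm_inv, norm_norm, inv_mul_cancel₀ (norm_ne_zero_iff.2 hx)]

lemma nrm_unit {x : E} (hx : ‖x‖ = 1) : nrm x = x := by simp [nrm, hx]

lemma nrm_contDiffAt {x : E} (hx : x ≠ 0) : ContDiffAt ℝ 2 (nrm : E → E) x :=
  ((contDiffAt_norm ℝ hx).inv (norm_ne_zero_iff.2 hx)).smul contDiffAt_id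

lemma norm_hasFDerivAt {e : E} (he : ‖e‖ = 1) :
    HasFDerivAt (fun x : E => ‖x‖) (innerSL ℝ e) e := by
  have h1 : HasFDerivAt (fun x : E => ‖x‖ ^ 2) (2 • (innerSL ℝ e)) e := by
    simpa using (hasFDerivAt_id (𝕜 := ℝ) e).norm_sq
  have h2 := h1.sqrt (by simp [he])
  have h3 : (fun x : E => √(‖x‖ ^ 2)) = fun x => ‖x‖ := by
    ext x; exact Real.sqrt_sq (norm_nonneg x)
  rw [h3] at h2
  convert h2 using 1
  ext v; simp [he]

lemma nrm_hasFDerivAt {e : E} (he : ‖e‖ = 1) :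
    HasFDerivAt (nrm : E → E) (ContinuousLinearMap.id ℝ E - (innerSL ℝ e).smulRight e) e := by
  have hi : HasDerivAt (fun t : ℝ => t⁻¹) (-((1:ℝ) ^ 2)⁻¹) (‖e‖) := by
    rw [he]; exact hasDerivAt_inv one_ne_zero
  have h1 := HasDerivAt.comp_hasFDerivAt (f := fun x : E => ‖x‖) e hi (norm_hasFDerivAt he)
  have h2 := h1.smul (hasFDerivAt_id (𝕜 := ℝ) e)
  refine HasFDerivAt.congr_fderiv h2 ?_
  ext v; simp [he, sub_eq_add_neg]

variable (Γ : Subgroup (E ≃ₗᵢ[ℝ] E)) [Fintype Γ]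

/-- The `Γ`-invariant map. -/
noncomputable def Fm (κ : ℝ) (x₀ x : E) : E :=
  (∑ L : Γ, wfun κ ⟪x, L.1 x₀⟫ • L.1.symm x) - x₀

lemma Fm_invariant (κ : ℝ) (x₀ x : E) (M : Γ) : Fm Γ κ x₀ (M.1 x) = Fm Γ κ x₀ x := by
  unfold Fm
  congr 1
  symm
  apply Fintype.sum_equiv (Equiv.mulLeft M)
  intro L
  have h1 : ((M * L : Γ) : E ≃ₗᵢ[ℝ] E) x₀ = M.1 (L.1 x₀) := rfl
  have h2 : ((M * L : Γ) : E ≃ₗᵢ[ℝ] E).symm (M.1 x) = L.1.symm x := by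
    rw [LinearIsometryEquiv.symm_apply_eq]
    show M.1 x = M.1 (L.1 (L.1.symm x))
    simp
  simp only [Equiv.coe_mulLeft]
  rw [h1, h2, LinearIsometryEquiv.inner_map_map]

lemma Fm_contDiff (κ : ℝ) (x₀ : E) : ContDiff ℝ 2 (Fm Γ κ x₀) := by
  unfold Fm
  apply ContDiff.sub _ contDiff_const
  apply ContDiff.sum
  intro L _
  exact ((wfun_contDiff κ).comp (contDiff_id.inner ℝ contDiff_const)).smul
    L.1.symm.contDiff

/-- admissible base points -/
structure Good (κ : ℝ) (x₀ : E) : Prop where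
  lt : κ < 1
  unit : ‖x₀‖ = 1
  sep : ∀ L M : Γ, ∀ x : E, ‖x‖ = 1 → κ < ⟪x, L.1 x₀⟫ → κ < ⟪x, M.1 x₀⟫ → L = M

variable {Γ} {κ : ℝ} {x₀ : E}

lemma Fm_out (h : Good Γ κ x₀) {x : E} (hx : ∀ L : Γ, ⟪x, L.1 x₀⟫ ≤ κ) :
    Fm Γ κ x₀ x = -x₀ := by
  unfold Fm
  rw [Finset.sum_eq_zero, zero_sub]
  intro L _
  rw [wfun_zero h.lt (hx L), zero_smul]

lemma Fm_in (h : Good Γ κ x₀) {x : E} (hu : ‖x‖ = 1) (L : Γ) (hx : κ < ⟪x, L.1 x₀⟫) :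
    Fm Γ κ x₀ x = wfun κ ⟪x, L.1 x₀⟫ • L.1.symm x - x₀ := by
  unfold Fm
  rw [Finset.sum_eq_single L]
  · intro M _ hM
    rw [wfun_zero h.lt, zero_smul]
    by_contra! h2
    exact hM (h.sep M L x hu h2 hx)
  · simp

lemma Fm_orbit (h : Good Γ κ x₀) (L : Γ) : Fm Γ κ x₀ (L.1 x₀) = x₀ := by
  have h1 : ⟪L.1 x₀, L.1 x₀⟫ = 1 := by
    rw [LinearIsometryEquiv.inner_map_map, real_inner_self_eq_norm_sq, h.unit]; norm_num
  rw [Fm_in h (by simp [h.unit]) L (by rw [h1]; exact h.lt), h1, wfun_one h.lt]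
  simp [two_smul]

lemma Fm_ray (h : Good Γ κ x₀) {x : E} (hu : ‖x‖ = 1) {l : ℝ} (hl : 0 ≤ l)
    (hx : Fm Γ κ x₀ x = l • x₀) : l = 1 ∧ ∃ L : Γ, x = L.1 x₀ := by
  have hx0 : x₀ ≠ 0 := by
    intro h0; have := h.unit; simp [h0] at this
  by_cases hc : ∃ L : Γ, κ < ⟪x, L.1 x₀⟫
  · obtain ⟨L, hL⟩ := hc
    rw [Fm_in h hu L hL] at hx
    have h2 : wfun κ ⟪x, L.1 x₀⟫ • L.1.symm x = (1 + l) • x₀ := by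
      rw [add_smul, one_smul, ← hx]; abel
    have h3 := congrArg norm h2
    rw [norm_smul, norm_smul, LinearIsometryEquiv.norm_map, hu, h.unit, Real.norm_eq_abs,
      Real.norm_eq_abs, abs_of_nonneg (wfun_nonneg _ _), abs_of_nonneg (by linarith),
      mul_one, mul_one] at h3
    rw [h3] at h2
    have h4 : L.1.symm x = x₀ := smul_right_injective E (by linarith : (1 + l) ≠ 0) h2
    have h5 : x = L.1 x₀ := by rw [← h4]; simp
    refine ⟨?_, L, h5⟩
    rw [h5, LinearIsometryEquiv.inner_map_map, real_inner_self_eq_norm_sq, h.unit, one_pow,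
      wfun_one h.lt] at h3
    linarith
  · push Not at hc
    rw [Fm_out h hc] at hx
    have : (l + 1) • x₀ = 0 := by rw [add_smul, ← hx]; simp
    rcases smul_eq_zero.1 this with h | h
    · linarith
    · exact absurd h hx0

lemma Fm_ne_zero (h : Good Γ κ x₀) {x : E} (hu : ‖x‖ = 1) : Fm Γ κ x₀ x ≠ 0 := by
  intro h0
  have := (Fm_ray h hu le_rfl (by rw [h0, zero_smul])).1
  norm_num at this

lemma Fm_hasFDerivAt (h : Good Γ κ x₀) (L : Γ) :
    HasFDerivAt (fun x => Fm Γ κ x₀ (nrm x))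
      ((L.1.symm : E →L[ℝ] E).comp (Tm (L.1 x₀) 0)) (L.1 x₀) := by
  set e := L.1 x₀ with hedef
  have he : ‖e‖ = 1 := by simp [e, h.unit]
  have hee : ⟪e, e⟫ = 1 := by rw [real_inner_self_eq_norm_sq, he]; norm_num
  have hn := nrm_hasFDerivAt he
  have h1 : HasFDerivAt (fun x => ⟪nrm x, e⟫)
      ((innerSL ℝ e).comp (ContinuousLinearMap.id ℝ E - (innerSL ℝ e).smulRight e)) e := by
    have := (innerSL ℝ e).hasFDerivAt.comp e hn
    refine this.congr_of_eventuallyEq (Filter.Eventually.of_forall fun x => ?_)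
    simp [real_inner_comm]
  have h2 : HasFDerivAt (fun x => wfun κ ⟪nrm x, e⟫) (0 : E →L[ℝ] ℝ) e := by
    have hw : HasDerivAt (wfun κ) 0 (⟪nrm e, e⟫) := by
      rw [nrm_unit he, hee]; exact wfun_deriv h.lt
    have := HasDerivAt.comp_hasFDerivAt (f := fun x => ⟪nrm x, e⟫) e hw h1
    rw [zero_smul] at this
    exact this
  have h3 : HasFDerivAt (fun x => L.1.symm (nrm x)) ((L.1.symm : E →L[ℝ] E).comp
      (ContinuousLinearMap.id ℝ E - (innerSL ℝ e).smulRight e)) e :=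
    (L.1.symm : E →L[ℝ] E).hasFDerivAt.comp e hn
  have h4 := (h2.smul h3).sub_const x₀
  have h5 : HasFDerivAt (fun x => wfun κ ⟪nrm x, e⟫ • L.1.symm (nrm x) - x₀)
      ((L.1.symm : E →L[ℝ] E).comp (Tm e 0)) e := by
    refine HasFDerivAt.congr_fderiv h4 ?_
    ext v
    simp [nrm_unit he, he, wfun_one h.lt, Tm_apply]
  refine h5.congr_of_eventuallyEq ?_
  have hcont : ContinuousAt (fun x => ⟪nrm x, e⟫) e := h1.continuousAt
  have hev : ∀ᶠ x in 𝓝 e, κ < ⟪nrm x, e⟫ := by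
    apply hcont.eventually (lt_mem_nhds _)
    show κ < ⟪nrm e, e⟫
    rw [nrm_unit he, hee]; exact h.lt
  have hev2 : ∀ᶠ x in 𝓝 e, x ≠ 0 :=
    isOpen_ne.mem_nhds (by intro h0; simp [h0] at he)
  filter_upwards [hev, hev2] with x hx hx0
  exact Fm_in h (norm_nrm hx0) L hx

lemma Fm_hasFDerivAt_out (h : Good Γ κ x₀) {e : E} (he : ‖e‖ = 1)
    (hout : ∀ L : Γ, ⟪e, L.1 x₀⟫ < κ) :
    HasFDerivAt (fun x => Fm Γ κ x₀ (nrm x)) (0 : E →L[ℝ] E) e := by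
  refine (hasFDerivAt_const (-x₀) e).congr_of_eventuallyEq ?_
  have : ∀ᶠ x in 𝓝 e, ∀ L : Γ, ⟪nrm x, L.1 x₀⟫ < κ := by
    rw [Filter.eventually_all]
    intro L
    have hc : ContinuousAt (fun x : E => ⟪nrm x, L.1 x₀⟫) e :=
      (nrm_hasFDerivAt he).continuousAt.inner continuousAt_const
    apply hc.eventually (gt_mem_nhds _)
    show ⟪nrm e, L.1 x₀⟫ < κ
    rw [nrm_unit he]; exact hout L
  filter_upwards [this] with x hx
  exact Fm_out h fun L => (hx L).le

lemma Fm_nrm_contDiffAt {x : E} (hx : x ≠ 0) :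
    ContDiffAt ℝ 2 (fun x => Fm Γ κ x₀ (nrm x)) x :=
  (Fm_contDiff Γ κ x₀).contDiffAt.comp x (nrm_contDiffAt hx)

end
end EffSphere
set_option linter.unusedSectionVars false

namespace EffSphere
open MeasureTheory Topology

section
variable {E : Type*} [NormedAddCommGroup E] [InnerProductSpace ℝ E] [FiniteDimensional ℝ E]
local notation "⟪" x "," y "⟫" => inner ℝ x y

/-- open annulus -/
def ann (E : Type*) [NormedAddCommGroup E] (r R : ℝ) : Set E := {x | r < ‖x‖ ∧ ‖x‖ < R}

lemma isOpen_ann (r R : ℝ) : IsOpen (ann E r R) :=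
  (isOpen_lt continuous_const continuous_norm).inter (isOpen_lt continuous_norm continuous_const)

lemma isBounded_ann (r R : ℝ) : Bornology.IsBounded (ann E r R) :=
  Metric.isBounded_ball.subset (t := Metric.ball (0:E) R) fun x hx => by simpa using hx.2

lemma closure_ann {r R : ℝ} {x : E} (hx : x ∈ closure (ann E r R)) : r ≤ ‖x‖ :=
  closure_minimal (t := {x : E | r ≤ ‖x‖}) (fun _ h => h.1.le)
    (isClosed_le continuous_const continuous_norm) hx

lemma ann_bound {c C a b x : ℝ} (hc : 0 < c) (hx : 0 ≤ x) (ha : c ≤ a) (ha' : a ≤ C) (hb : c ≤ b)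
    (hb' : b ≤ C) (h : a = x * b) : c / (2 * C) < x ∧ x < 2 * C / c := by
  have hC : 0 < C := by linarith
  constructor
  · rw [div_lt_iff₀ (by positivity)]
    have : x * b ≤ x * C := by gcongr
    nlinarith
  · rw [lt_div_iff₀ hc]
    have : x * c ≤ x * b := by gcongr
    nlinarith

lemma nrm_continuousOn : ContinuousOn (nrm : E → E) {x | x ≠ 0} := fun _ hx =>
  (nrm_contDiffAt hx).continuousAt.continuousWithinAt

variable {Γ : Subgroup (E ≃ₗᵢ[ℝ] E)} [Fintype Γ] {κ : ℝ} {x₀ : E}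

lemma Fm_bounds (h : Good Γ κ x₀) : ∃ c C : ℝ, 0 < c ∧ ∀ x : E, ‖x‖ = 1 →
    c ≤ ‖Fm Γ κ x₀ x‖ ∧ ‖Fm Γ κ x₀ x‖ ≤ C := by
  have hS : IsCompact (Metric.sphere (0:E) 1) := isCompact_sphere _ _
  have hF : ContinuousOn (Fm Γ κ x₀) (Metric.sphere (0:E) 1) :=
    (Fm_contDiff Γ κ x₀).continuous.continuousOn
  obtain ⟨C, hC⟩ := hS.exists_bound_of_continuousOn hF
  obtain ⟨c, hc, hc'⟩ := hS.exists_forall_le' hF.norm (a := 0)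
    (fun x hx => norm_pos_iff.2 (Fm_ne_zero h (by simpa using hx)))
  exact ⟨c, C, hc, fun x hx => ⟨hc' x (by simpa using hx), hC x (by simpa using hx)⟩⟩

lemma symm_det (hdet : ∀ L : Γ, LinearMap.det (L.1.toLinearEquiv : E →ₗ[ℝ] E) = 1) (L : Γ) :
    ((L.1.symm : E ≃ₗᵢ[ℝ] E) : E →L[ℝ] E).det = 1 := hdet L⁻¹

/-- Lower bound: no homotopy on the sphere from the invariant map to the constant map. -/
theorem lower_one (h : Good Γ κ x₀)
    (hdet : ∀ L : Γ, LinearMap.det (L.1.toLinearEquiv : E →ₗ[ℝ] E) = 1)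
    (Q : ℝ × E → E) (hQ : ContinuousOn Q (Icc (0:ℝ) 1 ×ˢ Metric.sphere (0:E) 1))
    (hQ0 : ∀ x, ‖x‖ = 1 → Q (0, x) = Fm Γ κ x₀ x)
    (hQ1 : ∀ x, ‖x‖ = 1 → Q (1, x) = - x₀)
    (hQr : ∀ t ∈ Icc (0:ℝ) 1, ∀ x, ‖x‖ = 1 → ∃ y, ‖y‖ = 1 ∧ Q (t, x) = Fm Γ κ x₀ y) : False := by
  obtain ⟨c, C, hc, hcC⟩ := Fm_bounds h
  have hx0 : x₀ ≠ 0 := by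
    intro h0; have := h.unit; simp [h0] at this
  have hcC' : c ≤ C := (hcC _ h.unit).1.trans (hcC _ h.unit).2
  have hC : 0 < C := by linarith
  -- normalise bounds so that `1` lies between them
  set c' := min c 1
  set C' := max C 1
  have hc' : 0 < c' := lt_min hc one_pos
  have hC' : 0 < C' := lt_max_of_lt_left hC
  have hne : ∀ x ∈ closure (ann E (c' / (2 * C')) (2 * C' / c')), x ≠ 0 := by
    intro x hx h0
    have := closure_ann hx
    rw [h0, norm_zero] at this
    have : 0 < c' / (2 * C') := by positivity
    linarith
  have key : ∀ t ∈ Icc (0:ℝ) 1, ∀ x : E, x ≠ 0 → Q (t, nrm x) - ‖x‖ • x₀ = 0 →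
      c' / (2 * C') < ‖x‖ ∧ ‖x‖ < 2 * C' / c' := by
    intro t ht x hx0 hx
    obtain ⟨y, hy, hQy⟩ := hQr t ht _ (norm_nrm hx0)
    have h2 := congrArg norm (sub_eq_zero.1 hx)
    rw [norm_smul, norm_norm, h.unit, hQy] at h2
    exact ann_bound hc' (norm_nonneg x) ((min_le_left _ _).trans (hcC y hy).1)
      ((hcC y hy).2.trans (le_max_left _ _)) (min_le_right _ _) (le_max_right _ _) h2
  have hzero : ∀ x : E, x ≠ 0 → Q (0, nrm x) - ‖x‖ • x₀ = 0 → ∃ L : Γ, x = L.1 x₀ := by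
    intro x hx h0
    rw [hQ0 _ (norm_nrm hx)] at h0
    obtain ⟨h1, L, hL⟩ := Fm_ray h (norm_nrm hx) (norm_nonneg x) (sub_eq_zero.1 h0)
    rw [nrm_unit h1] at hL
    exact ⟨L, hL⟩
  have hloc : ∀ x : E, x ≠ 0 → (fun x => Q (0, nrm x) - ‖x‖ • x₀) =ᶠ[𝓝 x]
      (fun x => Fm Γ κ x₀ (nrm x) - ‖x‖ • x₀) := by
    intro x hx
    filter_upwards [isOpen_ne.mem_nhds hx] with y hy
    rw [hQ0 _ (norm_nrm hy)]
  have hn0 : nrm x₀ = x₀ := nrm_unit h.unit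
  have z0 : Q (0, nrm x₀) - ‖x₀‖ • x₀ = 0 := by
    rw [hn0, hQ0 _ h.unit, h.unit, one_smul]
    have := Fm_orbit h 1
    simp only [OneMemClass.coe_one, LinearIsometryEquiv.coe_one, id_eq] at this
    rw [this, sub_self]
  refine no_homotopy (Ω := ann E (c' / (2 * C')) (2 * C' / c')) (isOpen_ann _ _)
    (isBounded_ann _ _) (fun t x => Q (t, nrm x) - ‖x‖ • x₀) ?_ ?_ ?_ ?_ (-1) ?_ x₀
    (key 0 (by simp) x₀ hx0 z0) z0
  · have h1 : ContinuousOn (fun p : ℝ × E => Q (p.1, nrm p.2))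
        (Icc (0:ℝ) 1 ×ˢ closure (ann E (c' / (2 * C')) (2 * C' / c'))) := by
      apply hQ.comp
      · apply continuousOn_fst.prodMk
        exact nrm_continuousOn.comp continuousOn_snd fun p hp => hne _ hp.2
      · rintro ⟨t, x⟩ ⟨ht, hx⟩
        exact ⟨ht, by simpa using norm_nrm (hne x hx)⟩
    exact h1.sub (by fun_prop)
  · intro t ht x hx hxO h0
    exact hxO (key t ht x (hne x hx) h0)
  · intro x hx h0
    change Q (1, nrm x) - ‖x‖ • x₀ = 0 at h0
    rw [hQ1 _ (norm_nrm (hne x hx))] at h0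
    have : (1 + ‖x‖) • x₀ = 0 := by
      rw [add_smul, one_smul, ← neg_eq_zero, ← h0]; abel
    rcases smul_eq_zero.1 this with h | h
    · have := norm_nonneg x
      linarith
    · exact hx0 h
  · intro x hx
    have hx' := hne x (subset_closure hx)
    refine ContDiffAt.congr_of_eventuallyEq ?_ (hloc x hx')
    exact (Fm_nrm_contDiffAt hx').sub ((contDiffAt_norm ℝ hx').smul contDiffAt_const)
  · intro x hx h0
    have hx' := hne x (subset_closure hx)
    obtain ⟨L, rfl⟩ := hzero x hx' h0
    have he : ‖L.1 x₀‖ = 1 := by simp [h.unit]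
    have hd : HasFDerivAt (fun x => Q (0, nrm x) - ‖x‖ • x₀)
        ((L.1.symm : E →L[ℝ] E).comp (Tm (L.1 x₀) (-1))) (L.1 x₀) := by
      refine HasFDerivAt.congr_of_eventuallyEq ?_ (hloc _ hx')
      refine ((Fm_hasFDerivAt h L).sub ((norm_hasFDerivAt he).smul_const x₀)).congr_fderiv ?_
      ext v
      simp [Tm_apply, sub_eq_add_neg]
    rw [hd.fderiv, det_comp_clm, symm_det hdet]
    have := det_Tm_neg_one he
    linarith

end
end EffSphere
set_option linter.unusedSectionVars false

namespace EffSphere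
open MeasureTheory Topology

section
variable {E : Type*} [NormedAddCommGroup E] [InnerProductSpace ℝ E] [FiniteDimensional ℝ E]
local notation "⟪" x "," y "⟫" => inner ℝ x y

variable {Γ : Subgroup (E ≃ₗᵢ[ℝ] E)} [Fintype Γ] {κ : ℝ} {x₀ x₁ : E}

/-- The caps around the two orbits are disjoint. -/
def Far (Γ : Subgroup (E ≃ₗᵢ[ℝ] E)) (κ : ℝ) (x₀ x₁ : E) : Prop :=
  ∀ L M : Γ, ∀ x : E, ‖x‖ = 1 → κ ≤ ⟪x, L.1 x₀⟫ → κ ≤ ⟪x, M.1 x₁⟫ → False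

lemma Far.symm (h : Far Γ κ x₀ x₁) : Far Γ κ x₁ x₀ := fun L M x hx h1 h2 => h M L x hx h2 h1

lemma Far.out (h : Far Γ κ x₀ x₁) (h1 : Good Γ κ x₁) (M : Γ) (L : Γ) : ⟪M.1 x₁, L.1 x₀⟫ < κ := by
  by_contra! hc
  refine h L M (M.1 x₁) (by simp [h1.unit]) hc ?_
  rw [LinearIsometryEquiv.inner_map_map, real_inner_self_eq_norm_sq, h1.unit, one_pow]
  exact h1.lt.le

lemma Far.Fm (hf : Far Γ κ x₀ x₁) (h0 : Good Γ κ x₀) (h1 : Good Γ κ x₁) (M : Γ) :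
    Fm Γ κ x₀ (M.1 x₁) = -x₀ := Fm_out h0 fun L => (hf.out h1 M L).le

/-- The zeros. -/
lemma zeros (h0 : Good Γ κ x₀) (h1 : Good Γ κ x₁) (hf : Far Γ κ x₀ x₁) {x y : E} (hx : x ≠ 0)
    (hy : y ≠ 0) (e0 : Fm Γ κ x₀ (nrm y) + ‖x‖ • Fm Γ κ x₀ (nrm x) = 0)
    (e1 : Fm Γ κ x₁ (nrm y) + ‖y‖ • Fm Γ κ x₁ (nrm x) = 0) :
    ∃ g h : Γ, (x = g.1 x₀ ∧ y = h.1 x₁) ∨ (x = h.1 x₁ ∧ y = g.1 x₀) := by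
  have hxn := norm_pos_iff.2 hx
  have hyn := norm_pos_iff.2 hy
  have ux := norm_nrm hx
  have uy := norm_nrm hy
  by_cases hcap : ∃ L : Γ, κ < ⟪nrm x, L.1 x₀⟫
  · obtain ⟨L, hL⟩ := hcap
    have o1 : Fm Γ κ x₁ (nrm x) = -x₁ := Fm_out h1 fun M => by
      by_contra! hM
      exact hf L M _ ux hL.le hM.le
    rw [o1, smul_neg, ← sub_eq_add_neg, sub_eq_zero] at e1
    obtain ⟨n1, h, hh⟩ := Fm_ray h1 uy (norm_nonneg y) e1
    rw [hh, hf.Fm h0 h1] at e0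
    have e0' : Fm Γ κ x₀ (nrm x) = ‖x‖⁻¹ • x₀ := by
      rw [eq_inv_smul_iff₀ hxn.ne', ← sub_eq_zero, ← e0]; abel
    obtain ⟨n0, g, hg⟩ := Fm_ray h0 ux (by positivity) e0'
    refine ⟨g, h, Or.inl ⟨?_, ?_⟩⟩
    · rw [← hg, nrm_unit (inv_eq_one.1 n0)]
    · rw [← hh, nrm_unit n1]
  · push Not at hcap
    rw [Fm_out h0 hcap, smul_neg, ← sub_eq_add_neg, sub_eq_zero] at e0
    obtain ⟨n0, g, hg⟩ := Fm_ray h0 uy (norm_nonneg x) e0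
    rw [hg, hf.symm.Fm h1 h0] at e1
    have e1' : Fm Γ κ x₁ (nrm x) = ‖y‖⁻¹ • x₁ := by
      rw [eq_inv_smul_iff₀ hyn.ne', ← sub_eq_zero, ← e1]; abel
    obtain ⟨n1, h, hh⟩ := Fm_ray h1 ux (by positivity) e1'
    refine ⟨g, h, Or.inr ⟨?_, ?_⟩⟩
    · rw [← hh, nrm_unit n0]
    · rw [← hg, nrm_unit (inv_eq_one.1 n1)]

/-- the map at time zero -/
noncomputable def Psi (Γ : Subgroup (E ≃ₗᵢ[ℝ] E)) [Fintype Γ] (κ : ℝ) (x₀ x₁ : E) (z : E × E) :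
    E × E :=
  (Fm Γ κ x₀ (nrm z.2) + ‖z.1‖ • Fm Γ κ x₀ (nrm z.1),
    Fm Γ κ x₁ (nrm z.2) + ‖z.2‖ • Fm Γ κ x₁ (nrm z.1))

lemma Psi_contDiffAt {z : E × E} (h1 : z.1 ≠ 0) (h2 : z.2 ≠ 0) :
    ContDiffAt ℝ 2 (Psi Γ κ x₀ x₁) z := by
  have a1 : ∀ a : E, ContDiffAt ℝ 2 (fun z : E × E => Fm Γ κ a (nrm z.1)) z := fun a =>
    ContDiffAt.comp z (Fm_nrm_contDiffAt h1) contDiffAt_fst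
  have a2 : ∀ a : E, ContDiffAt ℝ 2 (fun z : E × E => Fm Γ κ a (nrm z.2)) z := fun a =>
    ContDiffAt.comp z (Fm_nrm_contDiffAt h2) contDiffAt_snd
  have n1 : ContDiffAt ℝ 2 (fun z : E × E => ‖z.1‖) z :=
    ContDiffAt.comp z (contDiffAt_norm ℝ h1) contDiffAt_fst
  have n2 : ContDiffAt ℝ 2 (fun z : E × E => ‖z.2‖) z :=
    ContDiffAt.comp z (contDiffAt_norm ℝ h2) contDiffAt_snd
  exact ((a2 _).add (n1.smul (a1 _))).prodMk ((a2 _).add (n2.smul (a1 _)))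

lemma Psi_fderiv {z : E × E} (u1 : ‖z.1‖ = 1) (u2 : ‖z.2‖ = 1)
    {A1 A2 B1 B2 : E →L[ℝ] E}
    (hA1 : HasFDerivAt (fun x => Fm Γ κ x₀ (nrm x)) A1 z.1)
    (hA2 : HasFDerivAt (fun x => Fm Γ κ x₀ (nrm x)) A2 z.2)
    (hB1 : HasFDerivAt (fun x => Fm Γ κ x₁ (nrm x)) B1 z.1)
    (hB2 : HasFDerivAt (fun x => Fm Γ κ x₁ (nrm x)) B2 z.2) :
    HasFDerivAt (Psi Γ κ x₀ x₁)
      ((A2.comp (ContinuousLinearMap.snd ℝ E E) +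
        ((A1 + (innerSL ℝ z.1).smulRight (Fm Γ κ x₀ z.1)).comp (ContinuousLinearMap.fst ℝ E E))).prod
       (B2.comp (ContinuousLinearMap.snd ℝ E E) +
        (B1.comp (ContinuousLinearMap.fst ℝ E E) +
          ((innerSL ℝ z.2).smulRight (Fm Γ κ x₁ z.1)).comp (ContinuousLinearMap.snd ℝ E E)))) z := by
  have f1 : HasFDerivAt (fun z : E × E => z.1) (ContinuousLinearMap.fst ℝ E E) z := hasFDerivAt_fst
  have f2 : HasFDerivAt (fun z : E × E => z.2) (ContinuousLinearMap.snd ℝ E E) z := hasFDerivAt_snd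
  have a1 := HasFDerivAt.comp (f := fun z : E × E => z.1) z hA1 f1
  have a2 := HasFDerivAt.comp (f := fun z : E × E => z.2) z hA2 f2
  have b1 := HasFDerivAt.comp (f := fun z : E × E => z.1) z hB1 f1
  have b2 := HasFDerivAt.comp (f := fun z : E × E => z.2) z hB2 f2
  have n1 := HasFDerivAt.comp (f := fun z : E × E => z.1) z (norm_hasFDerivAt u1) f1
  have n2 := HasFDerivAt.comp (f := fun z : E × E => z.2) z (norm_hasFDerivAt u2) f2
  refine ((a2.add (n1.smul a1)).prodMk (b2.add (n2.smul b1))).congr_fderiv ?_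
  ext v <;> simp [u1, u2, nrm_unit u1]

lemma prodMap_det (A B : E →L[ℝ] E) : (A.prodMap B).det = A.det * B.det :=
  LinearMap.det_prodMap (A : E →ₗ[ℝ] E) (B : E →ₗ[ℝ] E)

lemma Psi_det (h0 : Good Γ κ x₀) (h1 : Good Γ κ x₁) (hf : Far Γ κ x₀ x₁)
    (hdet : ∀ L : Γ, LinearMap.det (L.1.toLinearEquiv : E →ₗ[ℝ] E) = 1)
    (hodd : Odd (Module.finrank ℝ E)) {z : E × E} (hz1 : z.1 ≠ 0) (hz2 : z.2 ≠ 0)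
    (hz : Psi Γ κ x₀ x₁ z = 0) : (fderiv ℝ (Psi Γ κ x₀ x₁) z).det < 0 := by
  obtain ⟨x, y⟩ := z
  obtain ⟨g, h, ⟨rfl, rfl⟩ | ⟨rfl, rfl⟩⟩ := zeros h0 h1 hf hz1 hz2 (congrArg Prod.fst hz)
    (congrArg Prod.snd hz)
  · have u1 : ‖g.1 x₀‖ = 1 := by simp [h0.unit]
    have u2 : ‖h.1 x₁‖ = 1 := by simp [h1.unit]
    have hd := Psi_fderiv (z := (g.1 x₀, h.1 x₁)) u1 u2 (Fm_hasFDerivAt h0 g)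
      (Fm_hasFDerivAt_out h0 u2 (hf.out h1 h)) (Fm_hasFDerivAt_out h1 u1 (hf.symm.out h0 g))
      (Fm_hasFDerivAt h1 h)
    have hd2 : HasFDerivAt (Psi Γ κ x₀ x₁) (((g.1.symm : E →L[ℝ] E).comp (Tm (g.1 x₀) 1)).prodMap
        ((h.1.symm : E →L[ℝ] E).comp (Tm (h.1 x₁) (-1)))) (g.1 x₀, h.1 x₁) := by
      refine hd.congr_fderiv ?_
      rw [Fm_orbit h0, hf.symm.Fm h1 h0]
      ext v <;> simp [Tm_apply]
    rw [hd2.fderiv, prodMap_det, det_comp_clm, det_comp_clm, symm_det hdet, symm_det hdet,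
      one_mul, one_mul]
    exact mul_neg_of_pos_of_neg (det_Tm_one u1) (det_Tm_neg_one u2)
  · have u1 : ‖g.1 x₀‖ = 1 := by simp [h0.unit]
    have u2 : ‖h.1 x₁‖ = 1 := by simp [h1.unit]
    have hd := Psi_fderiv (z := (h.1 x₁, g.1 x₀)) u2 u1
      (Fm_hasFDerivAt_out h0 u2 (hf.out h1 h)) (Fm_hasFDerivAt h0 g)
      (Fm_hasFDerivAt h1 h) (Fm_hasFDerivAt_out h1 u1 (hf.symm.out h0 g))
    have hd2 : HasFDerivAt (Psi Γ κ x₀ x₁)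
        (((g.1.symm : E →L[ℝ] E).prodMap (h.1.symm : E →L[ℝ] E)).comp (Dm (g.1 x₀) (h.1 x₁)))
        (h.1 x₁, g.1 x₀) := by
      refine hd.congr_fderiv ?_
      rw [Fm_orbit h1, hf.Fm h0 h1]
      ext v <;> simp [Tm_apply, Dm_apply]
    rw [hd2.fderiv, det_comp_clm, prodMap_det, symm_det hdet, symm_det hdet, one_mul, one_mul]
    exact det_Dm u1 u2 hodd

/-- Lower bound for two sets. -/
theorem lower_two (h0 : Good Γ κ x₀) (h1 : Good Γ κ x₁) (hf : Far Γ κ x₀ x₁)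
    (hdet : ∀ L : Γ, LinearMap.det (L.1.toLinearEquiv : E →ₗ[ℝ] E) = 1)
    (hodd : Odd (Module.finrank ℝ E)) (q₀ q₁ : ℝ × (E × E) → E)
    (c0 : ContinuousOn q₀ (Icc (0:ℝ) 1 ×ˢ (Metric.sphere (0:E) 1 ×ˢ Metric.sphere (0:E) 1)))
    (c1 : ContinuousOn q₁ (Icc (0:ℝ) 1 ×ˢ (Metric.sphere (0:E) 1 ×ˢ Metric.sphere (0:E) 1)))
    (z0 : ∀ x y, ‖x‖ = 1 → ‖y‖ = 1 → q₀ (0, x, y) = Fm Γ κ x₀ y)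
    (z1 : ∀ x y, ‖x‖ = 1 → ‖y‖ = 1 → q₁ (0, x, y) = Fm Γ κ x₁ y)
    (hend : ∀ x y, ‖x‖ = 1 → ‖y‖ = 1 →
      q₀ (1, x, y) = Fm Γ κ x₀ x ∨ q₁ (1, x, y) = Fm Γ κ x₁ x)
    (r0 : ∀ t ∈ Icc (0:ℝ) 1, ∀ x y, ‖x‖ = 1 → ‖y‖ = 1 →
      ∃ a, ‖a‖ = 1 ∧ q₀ (t, x, y) = Fm Γ κ x₀ a)
    (r1 : ∀ t ∈ Icc (0:ℝ) 1, ∀ x y, ‖x‖ = 1 → ‖y‖ = 1 →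
      ∃ a, ‖a‖ = 1 ∧ q₁ (t, x, y) = Fm Γ κ x₁ a) : False := by
  obtain ⟨b0, C0, hb0, hbC0⟩ := Fm_bounds h0
  obtain ⟨b1, C1, hb1, hbC1⟩ := Fm_bounds h1
  have hx0 : x₀ ≠ 0 := by
    intro h; have := h0.unit; simp [h] at this
  have hx1 : x₁ ≠ 0 := by
    intro h; have := h1.unit; simp [h] at this
  set c := min b0 b1
  set C := max C0 C1
  have hc : 0 < c := lt_min hb0 hb1
  have hF0 : ∀ x : E, ‖x‖ = 1 → c ≤ ‖Fm Γ κ x₀ x‖ ∧ ‖Fm Γ κ x₀ x‖ ≤ C := fun x hx =>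
    ⟨(min_le_left _ _).trans (hbC0 x hx).1, (hbC0 x hx).2.trans (le_max_left _ _)⟩
  have hF1 : ∀ x : E, ‖x‖ = 1 → c ≤ ‖Fm Γ κ x₁ x‖ ∧ ‖Fm Γ κ x₁ x‖ ≤ C := fun x hx =>
    ⟨(min_le_right _ _).trans (hbC1 x hx).1, (hbC1 x hx).2.trans (le_max_right _ _)⟩
  have hC : 0 < C := lt_of_lt_of_le hc ((hF0 x₀ h0.unit).1.trans (hF0 x₀ h0.unit).2)
  set r := c / (2 * C)
  set R := 2 * C / c
  have hr : 0 < r := by positivity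
  set Ω : Set (E × E) := ann E r R ×ˢ ann E r R
  have hne : ∀ z ∈ closure Ω, z.1 ≠ 0 ∧ z.2 ≠ 0 := by
    intro z hz
    rw [closure_prod_eq] at hz
    constructor <;> rw [← norm_pos_iff]
    · exact hr.trans_le (closure_ann hz.1)
    · exact hr.trans_le (closure_ann hz.2)
  set Φ : ℝ → E × E → E × E := fun t z =>
    (q₀ (t, nrm z.1, nrm z.2) + ‖z.1‖ • Fm Γ κ x₀ (nrm z.1),
      q₁ (t, nrm z.1, nrm z.2) + ‖z.2‖ • Fm Γ κ x₁ (nrm z.1))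
  have key : ∀ t ∈ Icc (0:ℝ) 1, ∀ z : E × E, z.1 ≠ 0 → z.2 ≠ 0 → Φ t z = 0 → z ∈ Ω := by
    intro t ht z hz1 hz2 hz
    have u1 := norm_nrm hz1
    have u2 := norm_nrm hz2
    obtain ⟨a, ha, hqa⟩ := r0 t ht _ _ u1 u2
    obtain ⟨b, hb, hqb⟩ := r1 t ht _ _ u1 u2
    have e1 : q₀ (t, nrm z.1, nrm z.2) + ‖z.1‖ • Fm Γ κ x₀ (nrm z.1) = 0 := congrArg Prod.fst hz
    have e2 : q₁ (t, nrm z.1, nrm z.2) + ‖z.2‖ • Fm Γ κ x₁ (nrm z.1) = 0 := congrArg Prod.snd hz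
    rw [hqa] at e1
    rw [hqb] at e2
    have n1 := congrArg norm (eq_neg_of_add_eq_zero_left e1)
    have n2 := congrArg norm (eq_neg_of_add_eq_zero_left e2)
    rw [norm_neg, norm_smul, norm_norm] at n1 n2
    exact ⟨ann_bound hc (norm_nonneg _) (hF0 a ha).1 (hF0 a ha).2 (hF0 _ u1).1 (hF0 _ u1).2 n1,
      ann_bound hc (norm_nonneg _) (hF1 b hb).1 (hF1 b hb).2 (hF1 _ u1).1 (hF1 _ u1).2 n2⟩
  have hΦΨ : ∀ z : E × E, z.1 ≠ 0 → z.2 ≠ 0 → Φ 0 z = Psi Γ κ x₀ x₁ z := by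
    intro z hz1 hz2
    simp only [Φ, Psi, z0 _ _ (norm_nrm hz1) (norm_nrm hz2), z1 _ _ (norm_nrm hz1) (norm_nrm hz2)]
  have hloc : ∀ z : E × E, z.1 ≠ 0 → z.2 ≠ 0 → Φ 0 =ᶠ[𝓝 z] Psi Γ κ x₀ x₁ := by
    intro z hz1 hz2
    filter_upwards [(isOpen_ne.preimage continuous_fst).mem_nhds hz1,
      (isOpen_ne.preimage continuous_snd).mem_nhds hz2] with w hw1 hw2
    exact hΦΨ w hw1 hw2
  have hz0 : Φ 0 (x₀, x₁) = 0 := by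
    rw [hΦΨ _ hx0 hx1]
    have a1 := Fm_orbit h0 1
    have a2 := Fm_orbit h1 1
    have a3 := hf.Fm h0 h1 1
    have a4 := hf.symm.Fm h1 h0 1
    simp only [OneMemClass.coe_one, LinearIsometryEquiv.coe_one, id_eq] at a1 a2 a3 a4
    simp [Psi, nrm_unit h0.unit, nrm_unit h1.unit, a1, a2, a3, a4, h0.unit, h1.unit]
  refine no_homotopy (Ω := Ω) ((isOpen_ann _ _).prod (isOpen_ann _ _))
    ((isBounded_ann _ _).prod (isBounded_ann _ _)) Φ ?_ ?_ ?_ ?_ (-1) ?_ (x₀, x₁)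
    (key 0 (by simp) _ hx0 hx1 hz0) hz0
  · have hn1 : ContinuousOn (fun p : ℝ × (E × E) => nrm p.2.1) (Icc (0:ℝ) 1 ×ˢ closure Ω) :=
      nrm_continuousOn.comp (by fun_prop) fun p hp => (hne _ hp.2).1
    have hn2 : ContinuousOn (fun p : ℝ × (E × E) => nrm p.2.2) (Icc (0:ℝ) 1 ×ˢ closure Ω) :=
      nrm_continuousOn.comp (by fun_prop) fun p hp => (hne _ hp.2).2
    have hm : ContinuousOn (fun p : ℝ × (E × E) => (p.1, nrm p.2.1, nrm p.2.2))
        (Icc (0:ℝ) 1 ×ˢ closure Ω) := continuousOn_fst.prodMk (hn1.prodMk hn2)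
    have hmt : MapsTo (fun p : ℝ × (E × E) => (p.1, nrm p.2.1, nrm p.2.2))
        (Icc (0:ℝ) 1 ×ˢ closure Ω)
        (Icc (0:ℝ) 1 ×ˢ (Metric.sphere (0:E) 1 ×ˢ Metric.sphere (0:E) 1)) := by
      rintro ⟨t, z⟩ ⟨ht, hz⟩
      exact ⟨ht, by simpa using norm_nrm (hne z hz).1, by simpa using norm_nrm (hne z hz).2⟩
    have f0 := (Fm_contDiff Γ κ x₀).continuous.comp_continuousOn hn1
    have f1 := (Fm_contDiff Γ κ x₁).continuous.comp_continuousOn hn1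
    have g1 : ContinuousOn (fun p : ℝ × (E × E) => ‖p.2.1‖) (Icc (0:ℝ) 1 ×ˢ closure Ω) := by
      fun_prop
    have g2 : ContinuousOn (fun p : ℝ × (E × E) => ‖p.2.2‖) (Icc (0:ℝ) 1 ×ˢ closure Ω) := by
      fun_prop
    exact ((c0.comp hm hmt).add (g1.smul f0)).prodMk ((c1.comp hm hmt).add (g2.smul f1))
  · intro t ht z hz hzO h
    exact hzO (key t ht z (hne z hz).1 (hne z hz).2 h)
  · intro z hz h
    have u1 := norm_nrm (hne z hz).1
    have u2 := norm_nrm (hne z hz).2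
    have k : ∀ (a : ℝ) (v : E), 0 ≤ a → v + a • v = 0 → v = 0 := by
      intro a v ha hv
      have : (1 + a) • v = 0 := by rw [add_smul, one_smul, hv]
      rcases smul_eq_zero.1 this with h | h
      · linarith
      · exact h
    rcases hend _ _ u1 u2 with h2 | h2
    · have e1 : q₀ (1, nrm z.1, nrm z.2) + ‖z.1‖ • Fm Γ κ x₀ (nrm z.1) = 0 := congrArg Prod.fst h
      rw [h2] at e1
      exact Fm_ne_zero h0 u1 (k _ _ (norm_nonneg _) e1)
    · have e1 : q₁ (1, nrm z.1, nrm z.2) + ‖z.2‖ • Fm Γ κ x₁ (nrm z.1) = 0 := congrArg Prod.snd h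
      rw [h2] at e1
      exact Fm_ne_zero h1 u1 (k _ _ (norm_nonneg _) e1)
  · intro z hz
    have hz' := hne z (subset_closure hz)
    exact (Psi_contDiffAt hz'.1 hz'.2).congr_of_eventuallyEq (hloc z hz'.1 hz'.2)
  · intro z hz h
    have hz' := hne z (subset_closure hz)
    rw [(hloc z hz'.1 hz'.2).fderiv_eq]
    rw [hΦΨ z hz'.1 hz'.2] at h
    have := Psi_det h0 h1 hf hdet hodd hz'.1 hz'.2 h
    linarith

end
end EffSphere
set_option linter.unusedSectionVars false

namespace EffSphere
open MeasureTheory Topology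

/-- A planner gives a homotopy after applying an invariant map. -/
lemma planner_homotopy {G X Y : Type*} [Group G] [TopologicalSpace X] [MulAction G X]
    [TopologicalSpace Y] {k : ℕ} {hk : 0 < k} {U : Set (X × X)} (h : IsEffPlanner G X k hk U)
    (F : C(X, Y)) (hF : ∀ (g : G) x, F (g • x) = F x) :
    ∃ H : C(unitInterval × U, Y), (∀ u, H (0, u) = F u.1.1) ∧ (∀ u, H (1, u) = F u.1.2) := by
  obtain ⟨s, hs, hsk, hse⟩ := h
  let f : C(U, Y) := ⟨fun u => F u.1.1, by fun_prop⟩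
  have hsj : ∀ j : Fin k, Continuous fun u => s u j := fun j => (continuous_apply j).comp hs
  have hev : ∀ j : Fin k, Continuous fun p : unitInterval × U => F (s p.2 j p.1) := by
    intro j
    have h2 : Continuous fun p : unitInterval × U => s p.2 j p.1 := by
      have h3 := (hsj j).comp (continuous_snd (X := unitInterval) (Y := U))
      exact continuous_eval.comp (h3.prodMk continuous_fst)
    exact F.continuous.comp h2
  let e : Fin k → unitInterval → C(U, Y) := fun j t =>
    ⟨fun u => F (s u j t), (hev j).comp (continuous_const.prodMk continuous_id)⟩
  have hstep : ∀ j : Fin k, (e j 0).Homotopic (e j 1) := fun j =>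
    ⟨{ toFun := fun p => F (s p.2 j p.1)
       continuous_toFun := hev j
       map_zero_left := fun u => rfl
       map_one_left := fun u => rfl }⟩
  have key : ∀ j : ℕ, ∀ hj : j < k, f.Homotopic (e ⟨j, hj⟩ 1) := by
    intro j
    induction j with
    | zero =>
      intro hj
      have : f = e ⟨0, hj⟩ 0 := by
        ext u
        exact congrArg F (hse u).1.symm
      rw [this]; exact hstep _
    | succ j ih =>
      intro hj
      have h1 := ih (Nat.lt_of_succ_lt hj)
      have : e ⟨j, Nat.lt_of_succ_lt hj⟩ 1 = e ⟨j + 1, hj⟩ 0 := by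
        ext u
        obtain ⟨g, hg⟩ := hsk u j hj
        show F (s u ⟨j, Nat.lt_of_succ_lt hj⟩ 1) = F (s u ⟨j + 1, hj⟩ 0)
        rw [← hg, hF]
      rw [this] at h1
      exact h1.trans (hstep _)
  obtain ⟨H⟩ := key (k - 1) (Nat.sub_lt hk Nat.one_pos)
  refine ⟨H.toContinuousMap, fun u => ?_, fun u => ?_⟩
  · exact H.apply_zero u
  · refine (H.apply_one u).trans ?_
    exact congrArg F (hse u).2

lemma glue {Z Y : Type*} [TopologicalSpace Z] [TopologicalSpace Y] {U : Set Z} (hU : IsOpen U)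
    (φ : C(Z, ℝ)) (hφ : ∀ z, φ z ∈ Icc (0:ℝ) 1) (hs : tsupport φ ⊆ U)
    (H : C(unitInterval × U, Y)) (f : C(Z, Y)) (hf : ∀ u : U, H (1, u) = f u) :
    ∃ q : C(unitInterval × Z, Y), (∀ z, q (0, z) = f z) ∧
      (∀ z (hz : z ∈ U), φ z = 1 → q (1, z) = H (0, ⟨z, hz⟩)) ∧
      (∀ t z, (∃ p, q (t, z) = H p) ∨ q (t, z) = f z) := by
  classical
  let τ : unitInterval × Z → unitInterval := fun p => unitInterval.symm (p.1 * ⟨φ p.2, hφ p.2⟩)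
  have hτ : Continuous τ := by
    apply unitInterval.continuous_symm.comp
    apply continuous_fst.mul
    exact (φ.continuous.comp continuous_snd).subtype_mk _
  let q : unitInterval × Z → Y := fun p => if h : p.2 ∈ U then H (τ p, ⟨p.2, h⟩) else f p.2
  have τ1 : ∀ p : unitInterval × Z, φ p.2 = 0 → τ p = 1 := by
    intro p hp
    have : (⟨φ p.2, hφ p.2⟩ : unitInterval) = 0 := Subtype.ext hp
    simp [τ, this]
  have hq : Continuous q := by
    rw [continuous_iff_continuousAt]
    intro p
    by_cases hp : p.2 ∈ U
    · have hO : IsOpen {p : unitInterval × Z | p.2 ∈ U} := hU.preimage continuous_snd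
      suffices ContinuousOn q {p : unitInterval × Z | p.2 ∈ U} from
        this.continuousAt (hO.mem_nhds hp)
      rw [continuousOn_iff_continuous_domRestrict]
      have : ({p : unitInterval × Z | p.2 ∈ U}.domRestrict q) =
          fun p => H (τ p.1, ⟨p.1.2, p.2⟩) := by
        ext p
        have := p.2
        simp only [mem_ofPred_eq] at this
        simp [domRestrict, q, this]
      rw [this]
      apply H.continuous.comp
      exact (hτ.comp continuous_subtype_val).prodMk
        ((continuous_snd.comp continuous_subtype_val).subtype_mk _)
    · have hO : IsOpen {p : unitInterval × Z | p.2 ∈ (tsupport φ)ᶜ} :=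
        (isClosed_tsupport φ).isOpen_compl.preimage continuous_snd
      have h2 : ContinuousAt (fun p : unitInterval × Z => f p.2) p := by fun_prop
      apply h2.congr
      filter_upwards [hO.mem_nhds (show p.2 ∈ (tsupport φ)ᶜ from fun h => hp (hs h))] with y hy
      have h0 : φ y.2 = 0 := image_eq_zero_of_notMem_tsupport hy
      by_cases hyU : y.2 ∈ U
      · simp only [q, hyU, dif_pos, τ1 y h0]
        exact (hf ⟨y.2, hyU⟩).symm
      · simp [q, hyU]
  refine ⟨⟨q, hq⟩, fun z => ?_, fun z hz h1 => ?_, fun t z => ?_⟩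
  · by_cases hz : z ∈ U
    · have : τ (0, z) = 1 := by simp [τ]
      show q (0, z) = f z
      simp only [q, hz, dif_pos, this]
      exact hf ⟨z, hz⟩
    · simp [q, hz]
  · have e1 : (⟨φ z, hφ z⟩ : unitInterval) = 1 := Subtype.ext h1
    have : τ (1, z) = 0 := by simp [τ, e1]
    show q (1, z) = _
    simp only [q, hz, dif_pos, this]
  · by_cases hz : z ∈ U
    · left
      exact ⟨(τ (t, z), ⟨z, hz⟩), by simp [q, hz]⟩
    · right
      simp [q, hz]

lemma two_cutoffs {Z : Type*} [TopologicalSpace Z] [CompactSpace Z] [T2Space Z] {U₀ U₁ : Set Z}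
    (h0 : IsOpen U₀) (h1 : IsOpen U₁) (hc : U₀ ∪ U₁ = univ) :
    ∃ φ₀ φ₁ : C(Z, ℝ), (∀ z, φ₀ z ∈ Icc (0:ℝ) 1) ∧ (∀ z, φ₁ z ∈ Icc (0:ℝ) 1) ∧
      tsupport φ₀ ⊆ U₀ ∧ tsupport φ₁ ⊆ U₁ ∧ ∀ z, φ₀ z = 1 ∨ φ₁ z = 1 := by
  have hsub : U₀ᶜ ⊆ U₁ := by
    intro z hz
    rcases (hc ▸ mem_univ z : z ∈ U₀ ∪ U₁) with h | h
    · exact absurd h hz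
    · exact h
  obtain ⟨V, hV, hV0, hV1⟩ := normal_exists_closure_subset h0.isClosed_compl h1 hsub
  obtain ⟨φ₁, hs1, he1, hr1⟩ := exists_tsupport_one_of_isOpen_isClosed h1
    isClosed_closure.isCompact isClosed_closure hV1
  obtain ⟨φ₀, hs0, he0, hr0⟩ := exists_tsupport_one_of_isOpen_isClosed h0
    isClosed_closure.isCompact hV.isClosed_compl
    (compl_subset_comm.1 hV0)
  refine ⟨φ₀, φ₁, hr0, hr1, hs0, hs1, fun z => ?_⟩
  by_cases hz : z ∈ V
  · exact Or.inr (he1 (subset_closure hz))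
  · exact Or.inl (he0 hz)

end EffSphere
set_option linter.unusedSectionVars false

namespace EffSphere
open MeasureTheory Topology

section
variable {E : Type*} [NormedAddCommGroup E] [InnerProductSpace ℝ E] [FiniteDimensional ℝ E]
variable {Γ : Subgroup (E ≃ₗᵢ[ℝ] E)} [Fintype Γ] {κ : ℝ} {x₀ x₁ : E}
variable {G : Type*} [Group G] [MulAction G (Metric.sphere (0:E) 1)]

lemma continuousOn_dite {A B : Type*} [TopologicalSpace A] [TopologicalSpace B] {s : Set A}
    {f : A → B} (g : s → B) (hg : Continuous g) (hfg : ∀ a : s, f a = g a) : ContinuousOn f s := by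
  rw [continuousOn_iff_continuous_domRestrict]
  convert hg using 1
  ext a
  exact hfg a

/-- `Fm` as a map to its image of the sphere -/
noncomputable def FmC (Γ : Subgroup (E ≃ₗᵢ[ℝ] E)) [Fintype Γ] (κ : ℝ) (x₀ : E) :
    C(Metric.sphere (0:E) 1, {v : E // ∃ y, ‖y‖ = 1 ∧ v = Fm Γ κ x₀ y}) where
  toFun x := ⟨Fm Γ κ x₀ x, x, by simp, rfl⟩
  continuous_toFun :=
    ((Fm_contDiff Γ κ x₀).continuous.comp continuous_subtype_val).subtype_mk _

lemma FmC_inv (hG : ∀ g : G, ∃ L : Γ, ∀ x : Metric.sphere (0:E) 1, ((g • x : Metric.sphere (0:E) 1) : E) = L.1 x)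
    (g : G) (x : Metric.sphere (0:E) 1) : FmC Γ κ x₀ (g • x) = FmC Γ κ x₀ x := by
  obtain ⟨L, hL⟩ := hG g
  apply Subtype.ext
  show Fm Γ κ x₀ _ = Fm Γ κ x₀ _
  rw [hL, Fm_invariant]

theorem no_planner_univ (h0 : Good Γ κ x₀) (h1 : Good Γ κ x₁) (hf : Far Γ κ x₀ x₁)
    (hdet : ∀ L : Γ, LinearMap.det (L.1.toLinearEquiv : E →ₗ[ℝ] E) = 1)
    (hG : ∀ g : G, ∃ L : Γ, ∀ x : Metric.sphere (0:E) 1, ((g • x : Metric.sphere (0:E) 1) : E) = L.1 x)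
    {k : ℕ} {hk : 0 < k} (h : IsEffPlanner G (Metric.sphere (0:E) 1) k hk univ) : False := by
  classical
  obtain ⟨H, H0, H1⟩ := planner_homotopy h (FmC Γ κ x₀) (FmC_inv hG)
  let y₁ : Metric.sphere (0:E) 1 := ⟨x₁, by simp [h1.unit]⟩
  let Q : ℝ × E → E := fun p => if h : p ∈ Icc (0:ℝ) 1 ×ˢ Metric.sphere (0:E) 1 then
    (H (⟨p.1, h.1⟩, ⟨(⟨p.2, h.2⟩, y₁), mem_univ _⟩)).1 else 0
  have hQ : ∀ (t : ℝ) (ht : t ∈ Icc (0:ℝ) 1) (x : E) (hx : ‖x‖ = 1),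
      Q (t, x) = (H (⟨t, ht⟩, ⟨(⟨x, by simpa using hx⟩, y₁), mem_univ _⟩)).1 := by
    intro t ht x hx
    have : (t, x) ∈ Icc (0:ℝ) 1 ×ˢ Metric.sphere (0:E) 1 := ⟨ht, by simpa using hx⟩
    simp only [Q, this, dif_pos]
  apply lower_one h0 hdet Q
  · apply continuousOn_dite (fun p => (H (⟨p.1.1, p.2.1⟩, ⟨(⟨p.1.2, p.2.2⟩, y₁), mem_univ _⟩)).1)
    · apply continuous_subtype_val.comp
      apply H.continuous.comp
      fun_prop
    · intro p
      simp only [Q, p.2, dif_pos]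
  · intro x hx
    rw [hQ 0 (by simp) x hx]
    exact congrArg Subtype.val (H0 _)
  · intro x hx
    rw [hQ 1 (by simp) x hx]
    refine (congrArg Subtype.val (H1 _)).trans ?_
    have := hf.Fm h0 h1 1
    simp only [OneMemClass.coe_one, LinearIsometryEquiv.coe_one, id_eq] at this
    exact this
  · intro t ht x hx
    rw [hQ t ht x hx]
    exact (H _).2

theorem no_planner_two (h0 : Good Γ κ x₀) (h1 : Good Γ κ x₁) (hf : Far Γ κ x₀ x₁)
    (hdet : ∀ L : Γ, LinearMap.det (L.1.toLinearEquiv : E →ₗ[ℝ] E) = 1)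
    (hodd : Odd (Module.finrank ℝ E))
    (hG : ∀ g : G, ∃ L : Γ, ∀ x : Metric.sphere (0:E) 1, ((g • x : Metric.sphere (0:E) 1) : E) = L.1 x)
    {k : ℕ} {hk : 0 < k} {U V : Set (Metric.sphere (0:E) 1 × Metric.sphere (0:E) 1)}
    (hU : IsOpen U) (hV : IsOpen V) (hUV : U ∪ V = univ)
    (pU : IsEffPlanner G (Metric.sphere (0:E) 1) k hk U)
    (pV : IsEffPlanner G (Metric.sphere (0:E) 1) k hk V) : False := by
  classical
  obtain ⟨φ₀, φ₁, b0, b1, s0, s1, hφ⟩ := two_cutoffs hU hV hUV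
  obtain ⟨H, H0, H1⟩ := planner_homotopy pU (FmC Γ κ x₀) (FmC_inv hG)
  obtain ⟨K, K0, K1⟩ := planner_homotopy pV (FmC Γ κ x₁) (FmC_inv hG)
  obtain ⟨q, q0, q1, -⟩ := glue hU φ₀ b0 s0 H ((FmC Γ κ x₀).comp ContinuousMap.snd) H1
  obtain ⟨r, r0, r1, -⟩ := glue hV φ₁ b1 s1 K ((FmC Γ κ x₁).comp ContinuousMap.snd) K1
  let D : Set (ℝ × (E × E)) := Icc (0:ℝ) 1 ×ˢ (Metric.sphere (0:E) 1 ×ˢ Metric.sphere (0:E) 1)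
  have hD : ∀ (t : ℝ) (ht : t ∈ Icc (0:ℝ) 1) (x y : E) (hx : ‖x‖ = 1) (hy : ‖y‖ = 1),
      (t, x, y) ∈ D := fun t ht x y hx hy => ⟨ht, by simpa using hx, by simpa using hy⟩
  let m : D → unitInterval × (Metric.sphere (0:E) 1 × Metric.sphere (0:E) 1) := fun p =>
    (⟨p.1.1, p.2.1⟩, (⟨p.1.2.1, p.2.2.1⟩, ⟨p.1.2.2, p.2.2.2⟩))
  have hm : Continuous m := by fun_prop
  let Q : ℝ × (E × E) → E := fun p => if h : p ∈ D then (q (m ⟨p, h⟩)).1 else 0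
  let R : ℝ × (E × E) → E := fun p => if h : p ∈ D then (r (m ⟨p, h⟩)).1 else 0
  have hQ : ∀ p : D, Q p = (q (m p)).1 := fun p => dif_pos p.2
  have hR : ∀ p : D, R p = (r (m p)).1 := fun p => dif_pos p.2
  apply lower_two h0 h1 hf hdet hodd Q R
  · exact continuousOn_dite (s := D) (fun p => (q (m p)).1)
      (continuous_subtype_val.comp (q.continuous.comp hm)) hQ
  · exact continuousOn_dite (s := D) (fun p => (r (m p)).1)
      (continuous_subtype_val.comp (r.continuous.comp hm)) hR
  · intro x y hx hy
    rw [hQ ⟨_, hD 0 (by simp) x y hx hy⟩]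
    exact congrArg Subtype.val (q0 _)
  · intro x y hx hy
    rw [hR ⟨_, hD 0 (by simp) x y hx hy⟩]
    exact congrArg Subtype.val (r0 _)
  · intro x y hx hy
    let z : Metric.sphere (0:E) 1 × Metric.sphere (0:E) 1 :=
      (⟨x, by simpa using hx⟩, ⟨y, by simpa using hy⟩)
    rcases hφ z with h | h
    · left
      have hz : z ∈ U := s0 (subset_tsupport _ (by simp [h]))
      rw [hQ ⟨_, hD 1 (by simp) x y hx hy⟩]
      exact congrArg Subtype.val ((q1 z hz h).trans (H0 _))
    · right
      have hz : z ∈ V := s1 (subset_tsupport _ (by simp [h]))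
      rw [hR ⟨_, hD 1 (by simp) x y hx hy⟩]
      exact congrArg Subtype.val ((r1 z hz h).trans (K0 _))
  · intro t ht x y hx hy
    rw [hQ ⟨_, hD t ht x y hx hy⟩]
    exact (q _).2
  · intro t ht x y hx hy
    rw [hR ⟨_, hD t ht x y hx hy⟩]
    exact (r _).2

end
end EffSphere
set_option linter.unusedSectionVars false

namespace EffSphere
open MeasureTheory Topology

section
variable {E : Type*} [NormedAddCommGroup E] [InnerProductSpace ℝ E] [FiniteDimensional ℝ E]
local notation "⟪" x "," y "⟫" => inner ℝ x y

lemma isom_ext {L M : E ≃ₗᵢ[ℝ] E} (h : ∀ x : E, ‖x‖ = 1 → L x = M x) : L = M := by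
  ext x
  by_cases hx : x = 0
  · simp [hx]
  · have h1 := h (nrm x) (norm_nrm hx)
    have : x = ‖x‖ • nrm x := by
      rw [nrm, smul_smul, mul_inv_cancel₀ (norm_ne_zero_iff.2 hx), one_smul]
    rw [this, map_smul, map_smul, h1]

lemma cap_dist {κ : ℝ} {x a b : E} (hx : ‖x‖ = 1) (ha : ‖a‖ = 1) (hb : ‖b‖ = 1)
    (h1 : κ ≤ ⟪x, a⟫) (h2 : κ ≤ ⟪x, b⟫) : ‖a - b‖ ^ 2 ≤ 8 * (1 - κ) := by
  have e1 := norm_sub_sq_real x a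
  have e2 := norm_sub_sq_real x b
  rw [hx, ha] at e1
  rw [hx, hb] at e2
  have e3 : ‖a - b‖ ≤ ‖x - a‖ + ‖x - b‖ := by
    have := norm_add_le (a - x) (x - b)
    rw [sub_add_sub_cancel, norm_sub_rev a x] at this
    exact this
  have := norm_nonneg (a - b)
  nlinarith [sq_nonneg (‖x - a‖ - ‖x - b‖), norm_nonneg (x - a), norm_nonneg (x - b)]

variable (Γ : Subgroup (E ≃ₗᵢ[ℝ] E)) [Fintype Γ]

lemma exists_kappa {x₀ x₁ : E} (u0 : ‖x₀‖ = 1) (u1 : ‖x₁‖ = 1)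
    (f0 : ∀ L : Γ, L.1 x₀ = x₀ → L = 1) (f1 : ∀ L : Γ, L.1 x₁ = x₁ → L = 1)
    (hd : ∀ L M : Γ, L.1 x₀ ≠ M.1 x₁) :
    ∃ κ, Good Γ κ x₀ ∧ Good Γ κ x₁ ∧ Far Γ κ x₀ x₁ := by
  have hpair : ∀ a b : E, a ≠ b → ∀ᶠ κ in 𝓝[<] (1:ℝ), 8 * (1 - κ) < ‖a - b‖ ^ 2 := by
    intro a b hab
    have h1 : Filter.Tendsto (fun κ : ℝ => 8 * (1 - κ)) (𝓝[<] 1) (𝓝 0) := by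
      have : Continuous (fun κ : ℝ => 8 * (1 - κ)) := by fun_prop
      have h2 := this.tendsto 1
      simp only [sub_self, mul_zero] at h2
      exact h2.mono_left nhdsWithin_le_nhds
    have := norm_pos_iff.2 (sub_ne_zero.2 hab)
    exact h1.eventually (gt_mem_nhds (by positivity))
  have hfree : ∀ x : E, (∀ L : Γ, L.1 x = x → L = 1) → ∀ L M : Γ, L.1 x = M.1 x → L = M := by
    intro x hx L M h
    have h2 : (M⁻¹ * L).1 x = x := by
      show M.1.symm (L.1 x) = x
      rw [h]; simp
    have := hx _ h2
    exact (inv_mul_eq_one.1 this).symm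
  have hev : ∀ (x y : E), ∀ᶠ κ in 𝓝[<] (1:ℝ), ∀ L M : Γ, L.1 x ≠ M.1 y →
      8 * (1 - κ) < ‖L.1 x - M.1 y‖ ^ 2 := by
    intro x y
    rw [Filter.eventually_all]
    intro L
    rw [Filter.eventually_all]
    intro M
    by_cases h : L.1 x = M.1 y
    · exact Filter.Eventually.of_forall fun κ h2 => absurd h h2
    · filter_upwards [hpair _ _ h] with κ hκ _ using hκ
  have hlt : ∀ᶠ κ in 𝓝[<] (1:ℝ), κ < 1 := eventually_mem_nhdsWithin
  obtain ⟨κ, h1, h2, h3, h4⟩ :=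
    (hlt.and ((hev x₀ x₀).and ((hev x₁ x₁).and (hev x₀ x₁)))).exists
  refine ⟨κ, ⟨h1, u0, ?_⟩, ⟨h1, u1, ?_⟩, ?_⟩
  · intro L M x hx a b
    by_contra hLM
    have := h2 L M fun h => hLM (hfree _ f0 L M h)
    have := cap_dist hx (by simp [u0]) (by simp [u0]) a.le b.le
    linarith
  · intro L M x hx a b
    by_contra hLM
    have := h3 L M fun h => hLM (hfree _ f1 L M h)
    have := cap_dist hx (by simp [u1]) (by simp [u1]) a.le b.le
    linarith
  · intro L M x hx a b
    have := h4 L M (hd L M)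
    have := cap_dist hx (by simp [u0]) (by simp [u1]) a b
    linarith

/-- Choice of the base points. -/
lemma exists_points (hrank : 1 < Module.rank ℝ E) {p : ℕ} (hp : p.Prime)
    (ρ : Multiplicative (ZMod p) →* (E ≃ₗᵢ[ℝ] E)) (hρ : ρ.range = Γ) :
    ∃ x₀ x₁ : E, ‖x₀‖ = 1 ∧ ‖x₁‖ = 1 ∧ (∀ L : Γ, L.1 x₀ = x₀ → L = 1) ∧
      (∀ L : Γ, L.1 x₁ = x₁ → L = 1) ∧ ∀ L M : Γ, L.1 x₀ ≠ M.1 x₁ := by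
  have : Fact p.Prime := ⟨hp⟩
  have hcon : ConnectedSpace (Metric.sphere (0:E) 1) :=
    isConnected_iff_connectedSpace.1 (isConnected_sphere hrank 0 zero_le_one)
  have hnt : Nontrivial E := by
    rw [← rank_pos_iff_nontrivial (R := ℝ)]
    exact zero_lt_one.trans hrank
  have hntS : Nontrivial (Metric.sphere (0:E) 1) := by
    obtain ⟨v, hv⟩ := exists_norm_eq E (zero_le_one (α := ℝ))
    refine ⟨⟨v, by simpa using hv⟩, ⟨-v, by simpa using hv⟩, ?_⟩
    intro h
    have h2 : v = -v := congrArg Subtype.val h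
    have h3 : (2:ℝ) • v = 0 := by
      rw [two_smul]
      nth_rewrite 2 [h2]
      simp
    have : v = 0 := (smul_eq_zero.1 h3).resolve_left two_ne_zero
    simp [this] at hv
  obtain ⟨W, hW, hWne, hWf⟩ : ∃ W : Set (Metric.sphere (0:E) 1), IsOpen W ∧ W.Nonempty ∧
      ∀ x ∈ W, ∀ L : Γ, L.1 x = x → L = 1 := by
    by_cases htriv : ∀ L : Γ, L = 1
    · exact ⟨univ, isOpen_univ, univ_nonempty, fun x _ L _ => htriv L⟩
    · push Not at htriv
      obtain ⟨L, hL⟩ := htriv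
      refine ⟨{x | L.1 x ≠ x}, ?_, ?_, ?_⟩
      · exact isOpen_ne_fun (L.1.continuous.comp continuous_subtype_val) continuous_subtype_val
      · by_contra hne
        apply hL
        apply Subtype.ext
        apply isom_ext
        intro x hx
        by_contra h
        exact hne ⟨⟨x, by simpa using hx⟩, h⟩
      · intro x hx M hM
        let St : Subgroup (Multiplicative (ZMod p)) :=
          { carrier := {g | ρ g x = (x : E)}
            one_mem' := by simp
            mul_mem' := by
              intro a b ha hb
              show ρ (a * b) x = (x : E)
              rw [map_mul]
              show ρ a (ρ b x) = (x : E)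
              rw [show ρ b x = (x : E) from hb]; exact ha
            inv_mem' := by
              intro a ha
              show ρ a⁻¹ x = (x : E)
              rw [map_inv]
              show (ρ a).symm x = (x : E)
              rw [LinearIsometryEquiv.symm_apply_eq]
              exact (show ρ a x = (x : E) from ha).symm }
        have hcard : (Nat.card (Multiplicative (ZMod p))).Prime := by
          have : Nat.card (Multiplicative (ZMod p)) = p := by
            rw [Nat.card_congr Multiplicative.toAdd]; simp
          rw [this]; exact hp
        have : Fact (Nat.card (Multiplicative (ZMod p))).Prime := ⟨hcard⟩
        rcases St.eq_bot_or_eq_top_of_prime_card with h | h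
        · obtain ⟨m, hm⟩ : M.1 ∈ ρ.range := by rw [hρ]; exact M.2
          have : m ∈ St := by
            show ρ m x = (x : E)
            rw [hm]; exact hM
          rw [h, Subgroup.mem_bot] at this
          apply Subtype.ext
          rw [← hm, this, map_one]; rfl
        · exfalso
          obtain ⟨l, hl⟩ : L.1 ∈ ρ.range := by rw [hρ]; exact L.2
          have : l ∈ St := by rw [h]; trivial
          apply hx
          rw [← hl]; exact this
  obtain ⟨x₀, hx₀⟩ := hWne
  have hinf : W.Infinite := infinite_of_mem_nhds x₀ (hW.mem_nhds hx₀)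
  have hfin : (range fun L : Γ => L.1 (x₀ : E)).Finite := finite_range _
  have hfin2 : {y : Metric.sphere (0:E) 1 | (y : E) ∈ range fun L : Γ => L.1 (x₀ : E)}.Finite :=
    hfin.preimage Subtype.val_injective.injOn
  obtain ⟨x₁, hx₁, hx₁'⟩ := (hinf.sdiff hfin2).nonempty
  refine ⟨x₀, x₁, by simp, by simp, hWf x₀ hx₀, hWf x₁ hx₁, fun L M h => hx₁' ?_⟩
  refine ⟨M⁻¹ * L, ?_⟩
  show M.1.symm (L.1 x₀) = x₁
  rw [h]; simp

lemma det_pow (L : E ≃ₗᵢ[ℝ] E) (m : ℕ) :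
    LinearMap.det ((L ^ m).toLinearEquiv : E →ₗ[ℝ] E) =
      LinearMap.det (L.toLinearEquiv : E →ₗ[ℝ] E) ^ m := by
  induction m with
  | zero =>
    rw [pow_zero, pow_zero]
    exact LinearMap.det_id
  | succ m ih =>
    rw [pow_succ, pow_succ, ← ih, ← LinearMap.det_comp]
    rfl

end
end EffSphere
set_option linter.unusedSectionVars false

namespace EffSphere
open MeasureTheory Topology

section
variable {E : Type*} [NormedAddCommGroup E] [InnerProductSpace ℝ E]

/-- A planner built from three continuous families of paths. -/
lemma planner_of_three {G X : Type*} [Group G] [TopologicalSpace X] [MulAction G X]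
    {U : Set (X × X)} (F₀ F₁ F₂ : C(U × unitInterval, X))
    (h0 : ∀ u, F₀ (u, 0) = u.1.1) (h01 : ∀ u, F₁ (u, 0) = F₀ (u, 1))
    (h12 : ∀ u, F₂ (u, 0) = F₁ (u, 1)) (h2 : ∀ u, F₂ (u, 1) = u.1.2) {hk : 0 < 2 + 1} :
    IsEffPlanner G X (2 + 1) hk U := by
  refine ⟨fun u => ![F₀.curry u, F₁.curry u, F₂.curry u], ?_, ?_, ?_⟩
  · refine continuous_pi fun i => ?_
    fin_cases i
    · exact F₀.curry.continuous
    · exact F₁.curry.continuous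
    · exact F₂.curry.continuous
  · intro u i hi
    have : i = 0 ∨ i = 1 := by omega
    rcases this with rfl | rfl
    · refine ⟨1, ?_⟩
      show (1 : G) • F₀ (u, 1) = F₁ (u, 0)
      rw [one_smul, h01]
    · refine ⟨1, ?_⟩
      show (1 : G) • F₁ (u, 1) = F₂ (u, 0)
      rw [one_smul, h12]
  · intro u
    exact ⟨h0 u, h2 u⟩

lemma seg_ne_zero {x y : E} (hx : ‖x‖ = 1) (hy : ‖y‖ = 1) (h : x ≠ -y) {t : ℝ} (h0 : 0 ≤ t)
    (h1 : t ≤ 1) : (1 - t) • x + t • y ≠ 0 := by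
  intro h2
  have h3 : (1 - t) • x = -(t • y) := eq_neg_of_add_eq_zero_left h2
  have h4 := congrArg norm h3
  rw [norm_neg, norm_smul, norm_smul, hx, hy, Real.norm_of_nonneg (by linarith),
    Real.norm_of_nonneg h0] at h4
  have ht : t = 1 / 2 := by linarith
  subst ht
  apply h
  have h5 : (1 / 2 : ℝ) • x = (1 / 2 : ℝ) • (-y) := by
    rw [smul_neg, ← h3]; norm_num
  exact smul_right_injective E (by norm_num : (1 / 2 : ℝ) ≠ 0) h5

lemma exists_seg {U : Type*} [TopologicalSpace U] (f g : C(U, Metric.sphere (0:E) 1))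
    (h : ∀ u, (f u : E) ≠ -(g u : E)) :
    ∃ F : C(U × unitInterval, Metric.sphere (0:E) 1),
      (∀ u, F (u, 0) = f u) ∧ ∀ u, F (u, 1) = g u := by
  let w : U × unitInterval → E := fun p => (1 - (p.2 : ℝ)) • (f p.1 : E) + (p.2 : ℝ) • (g p.1 : E)
  have hw : Continuous w := by fun_prop
  have hne : ∀ p, w p ≠ 0 := fun p =>
    seg_ne_zero (by simp) (by simp) (h p.1) p.2.2.1 p.2.2.2
  have hc : Continuous fun p => ‖w p‖⁻¹ • w p :=
    (hw.norm.inv₀ fun p => norm_ne_zero_iff.2 (hne p)).smul hw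
  have hm : ∀ p, ‖w p‖⁻¹ • w p ∈ Metric.sphere (0:E) 1 := by
    intro p
    rw [mem_sphere_zero_iff_norm, norm_smul, norm_inv, norm_norm]
    exact inv_mul_cancel₀ (norm_ne_zero_iff.2 (hne p))
  refine ⟨⟨fun p => ⟨‖w p‖⁻¹ • w p, hm p⟩, hc.subtype_mk hm⟩, ?_, ?_⟩
  · intro u
    apply Subtype.ext
    simp [w]
  · intro u
    apply Subtype.ext
    simp [w]

lemma exists_rot {U : Type*} [TopologicalSpace U] (f g : C(U, Metric.sphere (0:E) 1))
    (h : ∀ u, inner ℝ (f u : E) (g u : E) = 0) :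
    ∃ F : C(U × unitInterval, Metric.sphere (0:E) 1),
      (∀ u, F (u, 0) = f u) ∧ ∀ u, (F (u, 1) : E) = -(f u : E) := by
  refine ⟨⟨fun p => ⟨Real.cos (Real.pi * p.2) • (f p.1 : E) + Real.sin (Real.pi * p.2) • (g p.1 : E),
    ?_⟩, ?_⟩, ?_, ?_⟩
  · rw [mem_sphere_zero_iff_norm, ← sq_eq_sq₀ (norm_nonneg _) zero_le_one, norm_add_sq_real,
      norm_smul, norm_smul, inner_smul_left, inner_smul_right, h]
    simp
  · refine Continuous.subtype_mk ?_ _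
    fun_prop
  · intro u
    apply Subtype.ext
    simp
  · intro u
    simp

variable {G : Type*} [Group G] [MulAction G (Metric.sphere (0:E) 1)]

local notation "SE" => Metric.sphere (0:E) 1

lemma planner_near {hk : 0 < 2 + 1} :
    IsEffPlanner G SE (2 + 1) hk {z : SE × SE | (z.1 : E) ≠ -(z.2 : E)} := by
  set U := {z : SE × SE | (z.1 : E) ≠ -(z.2 : E)}
  obtain ⟨F, F0, F1⟩ := exists_seg (U := U) (E := E) ⟨fun u => u.1.1, by fun_prop⟩
    ⟨fun u => u.1.2, by fun_prop⟩ (fun u => u.2)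
  let K : C(U × unitInterval, SE) := ⟨fun p => p.1.1.2, by fun_prop⟩
  exact planner_of_three F K K F0 (fun u => (F1 u).symm) (fun u => rfl) (fun u => rfl)

lemma planner_via {a b : SE} (hab : Joined a b) {hk : 0 < 2 + 1} :
    IsEffPlanner G SE (2 + 1) hk {z : SE × SE | (z.1 : E) ≠ -(a : E) ∧ (b : E) ≠ -(z.2 : E)} := by
  set U := {z : SE × SE | (z.1 : E) ≠ -(a : E) ∧ (b : E) ≠ -(z.2 : E)}
  obtain ⟨F, F0, F1⟩ := exists_seg (U := U) (E := E) ⟨fun u => u.1.1, by fun_prop⟩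
    (ContinuousMap.const _ a) (fun u => u.2.1)
  obtain ⟨F', F0', F1'⟩ := exists_seg (U := U) (E := E) (ContinuousMap.const _ b)
    ⟨fun u => u.1.2, by fun_prop⟩ (fun u => u.2.2)
  obtain ⟨P⟩ := hab
  let K : C(U × unitInterval, SE) := ⟨fun p => P p.2, by fun_prop⟩
  refine planner_of_three F K F' F0 (fun u => ?_) (fun u => ?_) F1'
  · rw [F1]; exact P.source
  · rw [F0']; exact P.target.symm

lemma planner_far (J : C(SE, SE)) (hJ : ∀ x : SE, inner ℝ (x : E) (J x : E) = 0) {hk : 0 < 2 + 1} :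
    IsEffPlanner G SE (2 + 1) hk {z : SE × SE | (z.1 : E) ≠ (z.2 : E)} := by
  set U := {z : SE × SE | (z.1 : E) ≠ (z.2 : E)}
  let f : C(U, SE) := ⟨fun u => -u.1.2, by fun_prop⟩
  obtain ⟨F, F0, F1⟩ := exists_seg (U := U) (E := E) ⟨fun u => u.1.1, by fun_prop⟩ f
    (fun u h => u.2 (by
      rw [show (u.1.1 : E) = -((f u : SE) : E) from h]; simp [f]))
  obtain ⟨R, R0, R1⟩ := exists_rot f (J.comp f) (fun u => hJ _)
  let K : C(U × unitInterval, SE) := ⟨fun p => p.1.1.2, by fun_prop⟩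
  refine planner_of_three F R K F0 (fun u => ?_) (fun u => ?_) (fun u => rfl)
  · rw [F1, R0]
  · apply Subtype.ext
    rw [R1]; simp [K, f]

end

/-- The index involution. -/
def swp (m : ℕ) (i : Fin (2 * m)) : Fin (2 * m) :=
  if h : i.1 % 2 = 0 then ⟨i.1 + 1, by have := i.2; omega⟩ else ⟨i.1 - 1, by have := i.2; omega⟩

lemma swp_val (m : ℕ) (i : Fin (2 * m)) :
    (swp m i).1 = if i.1 % 2 = 0 then i.1 + 1 else i.1 - 1 := by
  unfold swp
  split_ifs <;> rfl

lemma swp_swp (m : ℕ) (i : Fin (2 * m)) : swp m (swp m i) = i := by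
  apply Fin.ext
  rw [swp_val, swp_val]
  split_ifs <;> omega

/-- The sign. -/
def sgn (m : ℕ) (i : Fin (2 * m)) : ℝ := if i.1 % 2 = 0 then -1 else 1

lemma sgn_swp (m : ℕ) (i : Fin (2 * m)) : sgn m (swp m i) = - sgn m i := by
  unfold sgn
  rw [swp_val]
  split_ifs <;> first | omega | norm_num

lemma exists_J (m : ℕ) : ∃ J : C(Metric.sphere (0 : EuclideanSpace ℝ (Fin (2 * m))) 1,
    Metric.sphere (0 : EuclideanSpace ℝ (Fin (2 * m))) 1),
    ∀ x : Metric.sphere (0 : EuclideanSpace ℝ (Fin (2 * m))) 1, inner ℝ (x : EuclideanSpace ℝ (Fin (2 * m))) (J x : EuclideanSpace ℝ (Fin (2 * m))) = 0 := by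
  let J0 : EuclideanSpace ℝ (Fin (2 * m)) → EuclideanSpace ℝ (Fin (2 * m)) :=
    fun x => WithLp.toLp 2 fun i => sgn m i * x (swp m i)
  let e : Equiv.Perm (Fin (2 * m)) := ⟨swp m, swp m, swp_swp m, swp_swp m⟩
  have hsq : ∀ i, sgn m i ^ 2 = 1 := by
    intro i; unfold sgn; split_ifs <;> norm_num
  have hJn : ∀ x, ‖J0 x‖ = ‖x‖ := by
    intro x
    rw [EuclideanSpace.norm_eq, EuclideanSpace.norm_eq, ← Equiv.sum_comp e (fun i => ‖x i‖ ^ 2)]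
    congr 1
    refine Finset.sum_congr rfl fun i _ => ?_
    show ‖sgn m i * x (swp m i)‖ ^ 2 = ‖x (swp m i)‖ ^ 2
    rw [Real.norm_eq_abs, Real.norm_eq_abs, sq_abs, sq_abs, mul_pow, hsq, one_mul]
  have hJi : ∀ x, inner ℝ x (J0 x) = 0 := by
    intro x
    rw [PiLp.inner_apply]
    have h1 : ∑ i, inner ℝ (x i) (J0 x i) = ∑ i, sgn m i * (x i * x (swp m i)) := by
      refine Finset.sum_congr rfl fun i _ => ?_
      show inner ℝ (x i) (sgn m i * x (swp m i)) = _
      simp; ring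
    rw [h1]
    have h2 : ∑ i, sgn m i * (x i * x (swp m i)) = ∑ i, -(sgn m i * (x i * x (swp m i))) := by
      conv_lhs => rw [← Equiv.sum_comp e]
      refine Finset.sum_congr rfl fun i _ => ?_
      show sgn m (swp m i) * (x (swp m i) * x (swp m (swp m i))) = _
      rw [swp_swp, sgn_swp]; ring
    rw [Finset.sum_neg_distrib] at h2
    linarith
  have hc : Continuous J0 := by
    refine (PiLp.continuous_toLp 2 _).comp ?_
    fun_prop
  have hm : ∀ x : Metric.sphere (0 : EuclideanSpace ℝ (Fin (2 * m))) 1,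
      J0 x ∈ Metric.sphere (0 : EuclideanSpace ℝ (Fin (2 * m))) 1 := by
    intro x
    rw [mem_sphere_zero_iff_norm, hJn]; simp
  exact ⟨⟨fun x => ⟨J0 x, hm x⟩, (hc.comp continuous_subtype_val).subtype_mk hm⟩,
    fun x => hJi x⟩

end EffSphere
set_option linter.unusedSectionVars false

namespace EffSphere
open MeasureTheory Topology

section
variable {E : Type*} [NormedAddCommGroup E] [InnerProductSpace ℝ E] [FiniteDimensional ℝ E]
variable {p : ℕ} [MulAction (Multiplicative (ZMod p)) (Metric.sphere (0:E) 1)]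

/-- All the data needed for the lower bound. -/
lemma exists_data (hp : p.Prime) (hodd : Odd p) (hrank : 1 < Module.rank ℝ E)
    (horth : ∀ g : Multiplicative (ZMod p), ∃ L : E ≃ₗᵢ[ℝ] E,
      ∀ x : Metric.sphere (0:E) 1, ((g • x : Metric.sphere (0:E) 1) : E) = L x) :
    ∃ (Γ : Subgroup (E ≃ₗᵢ[ℝ] E)) (_ : Fintype Γ) (κ : ℝ) (x₀ x₁ : E),
      Good Γ κ x₀ ∧ Good Γ κ x₁ ∧ Far Γ κ x₀ x₁ ∧
      (∀ L : Γ, LinearMap.det (L.1.toLinearEquiv : E →ₗ[ℝ] E) = 1) ∧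
      ∀ g : Multiplicative (ZMod p), ∃ L : Γ, ∀ x : Metric.sphere (0:E) 1,
        ((g • x : Metric.sphere (0:E) 1) : E) = L.1 x := by
  have : Fact p.Prime := ⟨hp⟩
  have : NeZero p := ⟨hp.ne_zero⟩
  choose r hr using horth
  let ρ : Multiplicative (ZMod p) →* (E ≃ₗᵢ[ℝ] E) :=
    { toFun := r
      map_one' := by
        apply isom_ext
        intro x hx
        have := hr 1 ⟨x, by simpa using hx⟩
        rw [one_smul] at this
        exact this.symm
      map_mul' := by
        intro a b
        apply isom_ext
        intro x hx
        have h1 := hr (a * b) ⟨x, by simpa using hx⟩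
        rw [mul_smul, hr, hr] at h1
        exact h1.symm }
  have hfin : Finite ρ.range := Finite.of_surjective ρ.rangeRestrict ρ.rangeRestrict_surjective
  have hft : Fintype ρ.range := Fintype.ofFinite _
  obtain ⟨x₀, x₁, u0, u1, f0, f1, hd⟩ := exists_points ρ.range hrank hp ρ rfl
  obtain ⟨κ, g0, g1, hf⟩ := exists_kappa ρ.range u0 u1 f0 f1 hd
  refine ⟨ρ.range, hft, κ, x₀, x₁, g0, g1, hf, ?_, fun g => ⟨⟨ρ g, g, rfl⟩, hr g⟩⟩
  rintro ⟨_, g, rfl⟩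
  have hcard : Nat.card (Multiplicative (ZMod p)) = p := by
    rw [Nat.card_congr Multiplicative.toAdd]; simp
  have h1 : g ^ p = 1 := by
    have := pow_card_eq_one' (x := g)
    rwa [hcard] at this
  have h2 := det_pow (ρ g) p
  rw [← map_pow, h1, map_one] at h2
  have h3 : LinearMap.det ((1 : E ≃ₗᵢ[ℝ] E).toLinearEquiv : E →ₗ[ℝ] E) = 1 := LinearMap.det_id
  rw [h3, ← one_pow p] at h2
  exact (hodd.pow_injective h2).symm

lemma two_le (hp : p.Prime) (hodd : Odd p) (hrank : 1 < Module.rank ℝ E)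
    (horth : ∀ g : Multiplicative (ZMod p), ∃ L : E ≃ₗᵢ[ℝ] E,
      ∀ x : Metric.sphere (0:E) 1, ((g • x : Metric.sphere (0:E) 1) : E) = L x) :
    2 ≤ effTCinf (Multiplicative (ZMod p)) (Metric.sphere (0:E) 1) := by
  obtain ⟨Γ, _, κ, x₀, x₁, h0, h1, hf, hdet, hG⟩ := exists_data hp hodd hrank horth
  refine le_iInf fun k => le_sInf ?_
  rintro _ ⟨m, rfl, hm, U, hU, hcov, hpl⟩
  by_contra hlt
  have hm1 : m = 1 := by
    rw [not_le] at hlt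
    have : m < 2 := by exact_mod_cast hlt
    omega
  subst hm1
  have : U 0 = univ := by
    rw [← hcov]
    exact (iSup_unique (f := U)).symm
  have h := hpl 0
  rw [this] at h
  exact no_planner_univ h0 h1 hf hdet hG h

lemma three_le (hp : p.Prime) (hodd : Odd p) (hrank : 1 < Module.rank ℝ E)
    (hfr : Odd (Module.finrank ℝ E))
    (horth : ∀ g : Multiplicative (ZMod p), ∃ L : E ≃ₗᵢ[ℝ] E,
      ∀ x : Metric.sphere (0:E) 1, ((g • x : Metric.sphere (0:E) 1) : E) = L x) :
    3 ≤ effTCinf (Multiplicative (ZMod p)) (Metric.sphere (0:E) 1) := by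
  obtain ⟨Γ, _, κ, x₀, x₁, h0, h1, hf, hdet, hG⟩ := exists_data hp hodd hrank horth
  refine le_iInf fun k => le_sInf ?_
  rintro _ ⟨m, rfl, hm, U, hU, hcov, hpl⟩
  by_contra hlt
  have hm1 : m = 1 ∨ m = 2 := by
    rw [not_le] at hlt
    have : m < 3 := by exact_mod_cast hlt
    omega
  rcases hm1 with rfl | rfl
  · have : U 0 = univ := by
      rw [← hcov]
      exact (iSup_unique (f := U)).symm
    have h := hpl 0
    rw [this] at h
    exact no_planner_univ h0 h1 hf hdet hG h
  · have : U 0 ∪ U 1 = univ := by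
      rw [← hcov]
      ext z
      simp [Fin.exists_fin_two]
    exact no_planner_two h0 h1 hf hdet hfr hG (hU 0) (hU 1) this (hpl 0) (hpl 1)

end

section
variable {E : Type*} [NormedAddCommGroup E] [InnerProductSpace ℝ E]
variable {G : Type*} [Group G] [MulAction G (Metric.sphere (0:E) 1)]
local notation "SE" => Metric.sphere (0:E) 1

lemma unit_ne_neg {x : E} (hx : ‖x‖ = 1) : x ≠ -x := by
  intro h
  have h3 : (2:ℝ) • x = 0 := by
    rw [two_smul]
    nth_rewrite 2 [h]
    simp
  have : x = 0 := (smul_eq_zero.1 h3).resolve_left two_ne_zero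
  simp [this] at hx

lemma le_two (J : C(SE, SE)) (hJ : ∀ x : SE, inner ℝ (x : E) (J x : E) = 0) :
    effTCinf G SE ≤ 2 := by
  refine (iInf_le _ 2).trans (sInf_le ?_)
  refine ⟨2, rfl, by norm_num,
    ![{z : SE × SE | (z.1 : E) ≠ -(z.2 : E)}, {z : SE × SE | (z.1 : E) ≠ (z.2 : E)}], ?_, ?_, ?_⟩
  · intro i
    fin_cases i
    · exact isOpen_ne_fun (by fun_prop) (by fun_prop)
    · exact isOpen_ne_fun (by fun_prop) (by fun_prop)
  · rw [eq_univ_iff_forall]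
    intro z
    rw [mem_iUnion, Fin.exists_fin_two]
    by_cases h : (z.1 : E) = z.2
    · left
      show (z.1 : E) ≠ -(z.2 : E)
      rw [h]
      exact unit_ne_neg (by simp)
    · right; exact h
  · intro i
    fin_cases i
    · exact planner_near
    · exact planner_far J hJ

lemma le_three (hrank : 1 < Module.rank ℝ E) : effTCinf G SE ≤ 3 := by
  have hpc : PathConnectedSpace SE :=
    isPathConnected_iff_pathConnectedSpace.1 (isPathConnected_sphere hrank 0 zero_le_one)
  obtain ⟨a⟩ := hpc.nonempty
  have ha : (a : E) ≠ -(a : E) := unit_ne_neg (by simp)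
  refine (iInf_le _ 2).trans (sInf_le ?_)
  refine ⟨3, rfl, by norm_num,
    ![{z : SE × SE | (z.1 : E) ≠ -(z.2 : E)},
      {z : SE × SE | (z.1 : E) ≠ -(a : E) ∧ ((-a : SE) : E) ≠ -(z.2 : E)},
      {z : SE × SE | (z.1 : E) ≠ -((-a : SE) : E) ∧ (a : E) ≠ -(z.2 : E)}], ?_, ?_, ?_⟩
  · intro i
    fin_cases i
    · exact isOpen_ne_fun (by fun_prop) (by fun_prop)
    · exact (isOpen_ne_fun (by fun_prop) (by fun_prop)).inter
        (isOpen_ne_fun (by fun_prop) (by fun_prop))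
    · exact (isOpen_ne_fun (by fun_prop) (by fun_prop)).inter
        (isOpen_ne_fun (by fun_prop) (by fun_prop))
  · rw [eq_univ_iff_forall]
    intro z
    rw [mem_iUnion]
    by_cases h : (z.1 : E) = -(z.2 : E)
    · have h' : -(z.2 : E) = z.1 := h.symm
      by_cases h2 : (z.1 : E) = -(a : E)
      · refine ⟨2, ?_, ?_⟩
        · show (z.1 : E) ≠ -((-a : SE) : E)
          rw [h2]; simpa using ha.symm
        · show (a : E) ≠ -(z.2 : E)
          rw [h', h2]; exact ha
      · refine ⟨1, h2, ?_⟩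
        show ((-a : SE) : E) ≠ -(z.2 : E)
        rw [h']
        intro h3; exact h2 h3.symm
    · exact ⟨0, h⟩
  · intro i
    fin_cases i
    · exact planner_near
    · exact planner_via (PathConnectedSpace.joined _ _)
    · exact planner_via (PathConnectedSpace.joined _ _)

end
end EffSphere

/-- Let `p` be an odd prime acting on the unit sphere `S^n ⊆ ℝ^{n+1}` (via
`ℤ/p`) by orthogonal transformations, i.e. every group element acts as the restriction of a
linear isometry of the ambient space. Then `TC^{ℤ/p,∞}(S^n) = 2` if `n` is odd and
`TC^{ℤ/p,∞}(S^n) = 3` if `n` is even. -/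
theorem effTCinf_zmod_p_sphere (p n : ℕ) (hp : p.Prime) (hodd : Odd p) (hn : 1 ≤ n)
    [MulAction (Multiplicative (ZMod p))
      (Metric.sphere (0 : EuclideanSpace ℝ (Fin (n + 1))) 1)]
    (horth : ∀ g : Multiplicative (ZMod p),
      ∃ L : EuclideanSpace ℝ (Fin (n + 1)) ≃ₗᵢ[ℝ] EuclideanSpace ℝ (Fin (n + 1)),
        ∀ x : Metric.sphere (0 : EuclideanSpace ℝ (Fin (n + 1))) 1,
          ((g • x : Metric.sphere (0 : EuclideanSpace ℝ (Fin (n + 1))) 1) :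
            EuclideanSpace ℝ (Fin (n + 1))) = L x) :
    (Odd n → effTCinf (Multiplicative (ZMod p))
        (Metric.sphere (0 : EuclideanSpace ℝ (Fin (n + 1))) 1) = 2) ∧
    (Even n → effTCinf (Multiplicative (ZMod p))
        (Metric.sphere (0 : EuclideanSpace ℝ (Fin (n + 1))) 1) = 3) := by
  have hfr : Module.finrank ℝ (EuclideanSpace ℝ (Fin (n + 1))) = n + 1 := by simp
  have hrank : 1 < Module.rank ℝ (EuclideanSpace ℝ (Fin (n + 1))) := by
    rw [← Module.finrank_eq_rank, hfr]
    exact_mod_cast (by omega : 1 < n + 1)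
  refine ⟨fun h => le_antisymm ?_ (EffSphere.two_le hp hodd hrank horth),
    fun h => le_antisymm (EffSphere.le_three hrank)
      (EffSphere.three_le hp hodd hrank (by rw [hfr]; exact h.add_one) horth)⟩
  have hJ : ∃ J : C(Metric.sphere (0 : EuclideanSpace ℝ (Fin (n + 1))) 1,
      Metric.sphere (0 : EuclideanSpace ℝ (Fin (n + 1))) 1),
      ∀ x : Metric.sphere (0 : EuclideanSpace ℝ (Fin (n + 1))) 1,
        inner ℝ (x : EuclideanSpace ℝ (Fin (n + 1)))
        (J x : EuclideanSpace ℝ (Fin (n + 1))) = 0 := by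
    obtain ⟨m, hm⟩ := h
    have h2 : n + 1 = 2 * (m + 1) := by omega
    rw [h2]
    exact EffSphere.exists_J (m + 1)
  obtain ⟨J, hJ⟩ := hJ
  exact EffSphere.le_two J hJ
end

section
/- Let n ≥ 1 and let Z/2 act on the unit sphere S^n ⊆ ℝ^{n+1} by the antipodal involution x ↦ −x. Then the effective topological complexity satisfies TC^{Z/2,∞}(S^n) = 2. -/
open Set

/-- The action of `ℤ/2` on `X` generated by an involution `f`. -/
def involutionAction {X : Type*} (f : X → X) (hf : ∀ x, f (f x) = x) :
    MulAction (Multiplicative (ZMod 2)) X where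
  smul g x := if g.toAdd = 1 then f x else x
  one_smul x := by
    show (if (Multiplicative.toAdd (1 : Multiplicative (ZMod 2))) = 1 then f x else x) = x
    simp
  mul_smul a b x := by
    have hcases : ∀ z : ZMod 2, z = 0 ∨ z = 1 := by decide
    show (if (Multiplicative.toAdd (a * b)) = 1 then f x else x) =
      (if a.toAdd = 1 then f (if b.toAdd = 1 then f x else x) else (if b.toAdd = 1 then f x else x))
    rcases hcases a.toAdd with ha | ha <;> rcases hcases b.toAdd with hb | hb <;>
      simp [toAdd_mul, ha, hb, hf x]

open MeasureTheory in
theorem aux_integral_poly {α : Type*} [MeasurableSpace α] (μ : Measure α) (F : ℝ → α → ℝ) (N : ℕ)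
    (hF : ∀ x, ∃ p : Polynomial ℝ, p.natDegree ≤ N ∧ ∀ t, p.eval t = F t x)
    (hint : ∀ t, Integrable (F t) μ) :
    ∃ P : Polynomial ℝ, ∀ t, P.eval t = ∫ x, F t x ∂μ := by
  classical
  set s := Finset.range (N + 1)
  set v : ℕ → ℝ := fun i => (i : ℝ)
  have hv : Set.InjOn v s := fun a _ b _ h => by simpa [v] using h
  refine ⟨Lagrange.interpolate s v (fun i => ∫ x, F (v i) x ∂μ), fun t => ?_⟩
  have key : ∀ x, F t x = ∑ i ∈ s, F (v i) x * (Lagrange.basis s v i).eval t := by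
    intro x
    obtain ⟨p, hp, hpe⟩ := hF x
    have hd : p.degree < s.card := by
      simp only [s, Finset.card_range]
      exact lt_of_le_of_lt Polynomial.degree_le_natDegree (by exact_mod_cast Nat.lt_succ_of_le hp)
    have := Lagrange.eq_interpolate_of_eval_eq (r := fun i => F (v i) x) hv hd (fun i _ => hpe _)
    rw [← hpe t, this, Lagrange.interpolate_apply, Polynomial.eval_finsetSum]
    simp
  simp_rw [key]
  rw [integral_finsetSum _ (fun i _ => (hint _).mul_const _), Lagrange.interpolate_apply,
    Polynomial.eval_finsetSum]
  refine Finset.sum_congr rfl fun i _ => ?_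
  rw [integral_mul_const]
  simp

theorem aux_det_poly {n : ℕ} (A : EuclideanSpace ℝ (Fin n) →L[ℝ] EuclideanSpace ℝ (Fin n)) :
    ∃ p : Polynomial ℝ, p.natDegree ≤ n ∧ ∀ t : ℝ, p.eval t = (1 + t • A).det := by
  set b := (EuclideanSpace.basisFun (Fin n) ℝ).toBasis
  set M := LinearMap.toMatrix b b (A : EuclideanSpace ℝ (Fin n) →ₗ[ℝ] EuclideanSpace ℝ (Fin n))
  refine ⟨Matrix.det ((Polynomial.X : Polynomial ℝ) • M.map Polynomial.C + (1 : Matrix (Fin n) (Fin n) ℝ).map Polynomial.C), ?_, ?_⟩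
  · simpa using Polynomial.natDegree_det_X_add_C_le M 1
  · intro t
    rw [← Polynomial.coe_evalRingHom, RingHom.map_det]
    rw [ContinuousLinearMap.det, ← LinearMap.det_toMatrix b]
    congr 1
    have : LinearMap.toMatrix b b (((1 + t • A : EuclideanSpace ℝ (Fin n) →L[ℝ] EuclideanSpace ℝ (Fin n))) : EuclideanSpace ℝ (Fin n) →ₗ[ℝ] EuclideanSpace ℝ (Fin n)) = 1 + t • M := by
      simp [M, ContinuousLinearMap.toLinearMap_add]
    rw [this]
    ext i j
    by_cases h : i = j <;> simp [h, add_comm, mul_comm t]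

open MeasureTheory in
theorem aux_small {n : ℕ} (h : EuclideanSpace ℝ (Fin n) → EuclideanSpace ℝ (Fin n))
    (hc : ContDiff ℝ 1 h) (ρ : ℝ) (hsupp : ∀ x, ρ < ‖x‖ → h x = 0) :
    ∃ δ > 0, ∀ t : ℝ, 0 < t → t < δ → ∀ φ : EuclideanSpace ℝ (Fin n) → ℝ,
      ∫ x in Metric.closedBall 0 ρ, (1 + t • fderiv ℝ h x).det * φ (x + t • h x)
        = ∫ x in Metric.closedBall 0 ρ, φ x := by
  have hcs : HasCompactSupport h := by
    refine HasCompactSupport.of_support_subset_isCompact (isCompact_closedBall 0 ρ) ?_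
    intro x hx
    by_contra hx'
    exact hx (hsupp x (by simpa using hx'))
  obtain ⟨K, hK⟩ := hc.lipschitzWith_of_hasCompactSupport hcs (by simp)
  have hdet : ∀ᶠ A : EuclideanSpace ℝ (Fin n) →L[ℝ] EuclideanSpace ℝ (Fin n) in nhds 1,
      0 < A.det := by
    refine ContinuousLinearMap.continuous_det.continuousAt.eventually (lt_mem_nhds ?_)
    simp [ContinuousLinearMap.det]
  obtain ⟨η, hη, hηd⟩ := Metric.eventually_nhds_iff.1 hdet
  have hK1 : (0 : ℝ) < K + 1 := by positivity
  refine ⟨min (η / (K + 1)) (1 / (K + 1)), by positivity, fun t ht htδ φ => ?_⟩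
  have h1 : t * (K + 1) < η := by
    have := lt_of_lt_of_le htδ (min_le_left _ _)
    rwa [lt_div_iff₀ hK1] at this
  have h2 : t * (K + 1) < 1 := by
    have := lt_of_lt_of_le htδ (min_le_right _ _)
    rwa [lt_div_iff₀ hK1] at this
  set g : EuclideanSpace ℝ (Fin n) → EuclideanSpace ℝ (Fin n) := fun x => x + t • h x with hg
  have happ : ApproximatesLinearOn g
      ((ContinuousLinearEquiv.refl ℝ (EuclideanSpace ℝ (Fin n)) :
        EuclideanSpace ℝ (Fin n) ≃L[ℝ] EuclideanSpace ℝ (Fin n)) :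
        EuclideanSpace ℝ (Fin n) →L[ℝ] EuclideanSpace ℝ (Fin n)) univ (t.toNNReal * K) := by
    intro x _ y _
    have : g x - g y - (x - y) = t • (h x - h y) := by simp only [hg]; module
    simp only [ContinuousLinearEquiv.coe_refl, ContinuousLinearMap.coe_id', id, this]
    rw [norm_smul, Real.norm_of_nonneg ht.le, NNReal.coe_mul, Real.coe_toNNReal _ ht.le, mul_assoc]
    exact mul_le_mul_of_nonneg_left (hK.norm_sub_le x y) ht.le
  have hN : Subsingleton (EuclideanSpace ℝ (Fin n)) ∨ (t.toNNReal * K : NNReal) <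
      ‖((ContinuousLinearEquiv.refl ℝ (EuclideanSpace ℝ (Fin n))).symm :
        EuclideanSpace ℝ (Fin n) →L[ℝ] EuclideanSpace ℝ (Fin n))‖₊⁻¹ := by
    rcases subsingleton_or_nontrivial (EuclideanSpace ℝ (Fin n)) with hs | hs
    · exact Or.inl hs
    · right
      have : ‖((ContinuousLinearEquiv.refl ℝ (EuclideanSpace ℝ (Fin n))).symm :
        EuclideanSpace ℝ (Fin n) →L[ℝ] EuclideanSpace ℝ (Fin n))‖₊ = 1 := by
        have : ‖ContinuousLinearMap.id ℝ (EuclideanSpace ℝ (Fin n))‖₊ = 1 := by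
          ext; simp
        simp
      rw [this, inv_one, ← NNReal.coe_lt_coe]
      rw [NNReal.coe_mul, Real.coe_toNNReal _ ht.le, NNReal.coe_one]
      nlinarith
  have hinj : Function.Injective g := by
    have := happ.injOn hN
    exact Set.injOn_univ.1 this
  have hsurj : Function.Surjective g := happ.surjective hN
  have himg : g '' Metric.closedBall 0 ρ = Metric.closedBall 0 ρ := by
    have hout : ∀ x, x ∉ Metric.closedBall (0 : EuclideanSpace ℝ (Fin n)) ρ → g x = x := by
      intro x hx
      simp [hg, hsupp x (by simpa using hx)]
    ext y
    constructor
    · rintro ⟨x, hx, rfl⟩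
      by_contra hy
      have := hinj (hout _ hy)
      rw [this] at hy
      exact hy hx
    · intro hy
      obtain ⟨x, rfl⟩ := hsurj y
      refine ⟨x, ?_, rfl⟩
      by_contra hx
      rw [hout x hx] at hy
      exact hx hy
  have hder : ∀ x, HasFDerivAt g (1 + t • fderiv ℝ h x) x := by
    intro x
    have := (hc.differentiable (by simp) x).hasFDerivAt
    exact (hasFDerivAt_id x).add (this.const_smul t)
  have := integral_image_eq_integral_abs_det_fderiv_smul volume
    (measurableSet_closedBall (x := (0 : EuclideanSpace ℝ (Fin n))) (ε := ρ))
    (fun x _ => (hder x).hasFDerivWithinAt) hinj.injOn φ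
  rw [himg] at this
  rw [this]
  refine integral_congr_ae (Filter.Eventually.of_forall fun x => ?_)
  have hpos : 0 < (1 + t • fderiv ℝ h x).det := by
    apply hηd
    rw [dist_eq_norm, add_sub_cancel_left, norm_smul, Real.norm_of_nonneg ht.le]
    have := norm_fderiv_le_of_lipschitz ℝ hK (x₀ := x)
    nlinarith
  simp only [smul_eq_mul, abs_of_pos hpos]
  rfl

open MeasureTheory in
theorem aux_nozero {n : ℕ} (h : EuclideanSpace ℝ (Fin n) → EuclideanSpace ℝ (Fin n))
    (hc : ContDiff ℝ 1 h) (ρ : ℝ) (hρ : 0 < ρ) (hsupp : ∀ x, ρ < ‖x‖ → h x = 0)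
    (hne : ∀ x, x + h x ≠ 0) : False := by
  obtain ⟨δ, hδ, hsmall⟩ := aux_small h hc ρ hsupp
  set B : Set (EuclideanSpace ℝ (Fin n)) := Metric.closedBall 0 ρ with hB
  have hBc : IsCompact B := isCompact_closedBall 0 ρ
  have hBne : B.Nonempty := ⟨0, by simp [hB, hρ.le]⟩
  have hhc : Continuous h := hc.continuous
  have hfc : Continuous (fderiv ℝ h) := hc.continuous_fderiv (by simp)
  have hdc : ∀ t : ℝ, Continuous fun x => (1 + t • fderiv ℝ h x).det := fun t =>
    ContinuousLinearMap.continuous_det.comp (by fun_prop)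
  have hgc : Continuous fun x => ‖x + h x‖ := by fun_prop
  obtain ⟨x₀, hx₀, hmin⟩ := hBc.exists_isMinOn hBne hgc.continuousOn
  obtain ⟨x₁, hx₁, hmax⟩ := hBc.exists_isMaxOn hBne hgc.continuousOn
  obtain ⟨D, hD⟩ := hBc.exists_bound_of_continuousOn (hdc 1).continuousOn
  set ε := min ‖x₀ + h x₀‖ ρ with hε
  have hε0 : 0 < ε := lt_min (norm_pos_iff.2 (hne x₀)) hρ
  have hεg : ∀ x ∈ B, ε ≤ ‖x + h x‖ := fun x hx => (min_le_left _ _).trans (hmin hx)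
  set R := max ‖x₁ + h x₁‖ ρ with hR
  have hRg : ∀ x ∈ B, ‖x + h x‖ ≤ R := fun x hx => le_trans (hmax hx) (le_max_left _ _)
  have hεR : ε ≤ R := (min_le_right _ _).trans (le_max_right _ _)
  have hρR : ρ ≤ R := le_max_right _ _
  -- the polynomial identity at time one
  have key : ∀ m : ℕ, ∫ x in B, (1 + (1 : ℝ) • fderiv ℝ h x).det * (R ^ 2 - ‖x + (1 : ℝ) • h x‖ ^ 2) ^ m
      = ∫ x in B, (R ^ 2 - ‖x‖ ^ 2) ^ m := by
    intro m
    obtain ⟨P, hP⟩ := aux_integral_poly (volume.restrict B)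
      (fun t x => (1 + t • fderiv ℝ h x).det * (R ^ 2 - ‖x + t • h x‖ ^ 2) ^ m) (n + m * 2)
      (by
        intro x
        obtain ⟨p, hp, hpe⟩ := aux_det_poly (fderiv ℝ h x)
        refine ⟨p * (Polynomial.C (R ^ 2 - ‖x‖ ^ 2) -
          Polynomial.C (2 * inner ℝ x (h x)) * Polynomial.X -
          Polynomial.C (‖h x‖ ^ 2) * Polynomial.X ^ 2) ^ m, ?_, ?_⟩
        · refine Polynomial.natDegree_mul_le.trans (add_le_add hp ?_)
          refine Polynomial.natDegree_pow_le.trans (Nat.mul_le_mul_left _ ?_)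
          compute_degree
        · intro t
          rw [Polynomial.eval_mul, hpe, Polynomial.eval_pow]
          congr 2
          rw [norm_add_sq_real, norm_smul, inner_smul_right, mul_pow, Real.norm_eq_abs, sq_abs]
          simp
          ring)
      (by
        intro t
        have : Continuous fun x => (1 + t • fderiv ℝ h x).det * (R ^ 2 - ‖x + t • h x‖ ^ 2) ^ m := by
          have := hdc t
          fun_prop
        exact (this.continuousOn.integrableOn_compact hBc))
    have hPc : P = Polynomial.C (∫ x in B, (R ^ 2 - ‖x‖ ^ 2) ^ m) := by
      refine Polynomial.eq_of_infinite_eval_eq _ _ ((Set.Ioo_infinite hδ).mono ?_)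
      intro t ht
      simp only [Set.mem_ofPred_eq, Polynomial.eval_C]
      rw [hP]
      exact hsmall t ht.1 ht.2 (fun y => (R ^ 2 - ‖y‖ ^ 2) ^ m)
    rw [← hP 1, hPc, Polynomial.eval_C]
  set a := R ^ 2 - (ε / 2) ^ 2 with ha
  set b := R ^ 2 - ε ^ 2 with hb
  have hb0 : 0 ≤ b := by rw [hb]; nlinarith
  have hab : b < a := by rw [ha, hb]; nlinarith
  set V := volume.real B with hV
  set v := volume.real (Metric.closedBall (0 : EuclideanSpace ℝ (Fin n)) (ε / 2)) with hv
  have hv0 : 0 < v := by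
    rw [hv, Measure.real, ENNReal.toReal_pos_iff]
    exact ⟨Metric.measure_closedBall_pos _ _ (by positivity), measure_closedBall_lt_top⟩
  have upper : ∀ m : ℕ, ∫ x in B, (1 + (1 : ℝ) • fderiv ℝ h x).det * (R ^ 2 - ‖x + (1 : ℝ) • h x‖ ^ 2) ^ m
      ≤ D * b ^ m * V := by
    intro m
    refine (le_abs_self _).trans ?_
    rw [← Real.norm_eq_abs]
    refine norm_setIntegral_le_of_norm_le_const hBc.measure_lt_top ?_
    intro x hx
    rw [norm_mul]
    have h1 := hεg x hx
    have h2 := hRg x hx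
    have h3 : ‖(R ^ 2 - ‖x + (1 : ℝ) • h x‖ ^ 2) ^ m‖ ≤ b ^ m := by
      rw [one_smul, norm_pow, Real.norm_of_nonneg (by nlinarith [norm_nonneg (x + h x)])]
      refine pow_le_pow_left₀ (by nlinarith [norm_nonneg (x + h x)]) ?_ _
      rw [hb]; nlinarith
    exact mul_le_mul (hD x hx) h3 (norm_nonneg _) ((norm_nonneg _).trans (hD x hx))
  have lower : ∀ m : ℕ, a ^ m * v ≤ ∫ x in B, (R ^ 2 - ‖x‖ ^ 2) ^ m := by
    intro m
    have hcont : Continuous fun x : EuclideanSpace ℝ (Fin n) => (R ^ 2 - ‖x‖ ^ 2) ^ m := by fun_prop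
    have hsub : Metric.closedBall (0 : EuclideanSpace ℝ (Fin n)) (ε / 2) ⊆ B :=
      Metric.closedBall_subset_closedBall (by have := min_le_right ‖x₀ + h x₀‖ ρ; linarith)
    calc a ^ m * v ≤ ∫ x in Metric.closedBall (0 : EuclideanSpace ℝ (Fin n)) (ε / 2), (R ^ 2 - ‖x‖ ^ 2) ^ m := by
          rw [hv, mul_comm]
          have : volume.real (Metric.closedBall (0 : EuclideanSpace ℝ (Fin n)) (ε / 2)) * a ^ m
            = ∫ x in Metric.closedBall (0 : EuclideanSpace ℝ (Fin n)) (ε / 2), a ^ m := by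
            rw [setIntegral_const, smul_eq_mul]
          rw [this]
          refine setIntegral_mono_on ?_ (hcont.continuousOn.integrableOn_compact (isCompact_closedBall _ _)) measurableSet_closedBall ?_
          · exact continuousOn_const.integrableOn_compact (isCompact_closedBall _ _)
          · intro x hx
            have hx' : ‖x‖ ≤ ε / 2 := by simpa using hx
            refine pow_le_pow_left₀ (hb0.trans hab.le) ?_ _
            rw [ha]; nlinarith [norm_nonneg x]
      _ ≤ _ := by
          refine setIntegral_mono_set (hcont.continuousOn.integrableOn_compact hBc) ?_ hsub.eventuallyLE
          filter_upwards [ae_restrict_mem measurableSet_closedBall] with x hx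
          have hx' : ‖x‖ ≤ ρ := by simpa [hB] using hx
          have : 0 ≤ R ^ 2 - ‖x‖ ^ 2 := by nlinarith [norm_nonneg x]
          exact pow_nonneg this m
  have ha0 : 0 < a := lt_of_le_of_lt hb0 hab
  have hlim : Filter.Tendsto (fun m : ℕ => (D * V) * (b / a) ^ m) Filter.atTop (nhds ((D * V) * 0)) :=
    (tendsto_pow_atTop_nhds_zero_of_lt_one (by positivity) ((div_lt_one ha0).2 hab)).const_mul _
  have : v ≤ (D * V) * 0 := by
    refine ge_of_tendsto' hlim fun m => ?_
    rw [div_pow, ← mul_div_assoc, le_div_iff₀ (by positivity)]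
    have := (lower m).trans ((key m).symm.le.trans (upper m))
    linarith
  linarith

theorem aux_nozero_cont {n : ℕ} (h : EuclideanSpace ℝ (Fin n) → EuclideanSpace ℝ (Fin n))
    (hc : Continuous h) (hsupp : ∀ x, 1 ≤ ‖x‖ → h x = 0)
    (hne : ∀ x, 1 ≤ ‖x + h x‖) : False := by
  have hcs : HasCompactSupport h := by
    refine HasCompactSupport.of_support_subset_isCompact (isCompact_closedBall 0 1) ?_
    intro x hx
    by_contra hx'
    exact hx (hsupp x (by simpa using le_of_lt (not_le.1 (by simpa using hx'))))
  have huc : UniformContinuous h := hcs.uniformContinuous_of_continuous hc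
  obtain ⟨δ, hδ, hδ'⟩ := Metric.uniformContinuous_iff.1 huc (1/2) (by norm_num)
  obtain ⟨g, hg, hgd⟩ := hc.exists_contDiff_dist_le_of_forall_mem_ball_dist_le
    (lt_min hδ one_pos)
  refine aux_nozero g (hg.of_le (by exact_mod_cast le_top)) 2 (by norm_num) ?_ ?_
  · intro x hx
    have h0 : ∀ y ∈ Metric.ball x (min δ 1), h y = 0 := by
      intro y hy
      apply hsupp
      have h1 : dist y x < 1 := lt_of_lt_of_le hy (min_le_right _ _)
      rw [dist_eq_norm] at h1
      have := norm_sub_norm_le x y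
      rw [norm_sub_rev] at this
      linarith
    have hx0 : h x = 0 := h0 x (Metric.mem_ball_self (lt_min hδ one_pos))
    have := hgd x 0 (fun y hy => by rw [h0 y hy, hx0, dist_self])
    rw [hx0] at this
    exact dist_le_zero.1 this
  · intro x hx
    have := hgd x (1/2) (fun y hy => (hδ' (lt_of_lt_of_le hy (min_le_left _ _))).le)
    rw [dist_eq_norm] at this
    have h1 := hne x
    have h2 : x + h x = -(g x - h x) := by
      have h3 := eq_neg_of_add_eq_zero_left hx
      rw [neg_sub, sub_eq_add_neg, ← h3, add_comm]
    rw [h2, norm_neg] at h1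
    linarith

open Classical in
theorem aux_not_contractible {n : ℕ}
    (H : C(unitInterval × Metric.sphere (0 : EuclideanSpace ℝ (Fin n)) 1,
      Metric.sphere (0 : EuclideanSpace ℝ (Fin n)) 1))
    (c : Metric.sphere (0 : EuclideanSpace ℝ (Fin n)) 1)
    (h0 : ∀ x, H (0, x) = c) (h1 : ∀ x, H (1, x) = x) : False := by
  set u : EuclideanSpace ℝ (Fin n) → Metric.sphere (0 : EuclideanSpace ℝ (Fin n)) 1 :=
    fun x => if hx : x = 0 then c else ⟨‖x‖⁻¹ • x, by
      simp [norm_smul, norm_ne_zero_iff.2 hx]⟩ with hu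
  have huv : ∀ x, x ≠ 0 → (u x : EuclideanSpace ℝ (Fin n)) = ‖x‖⁻¹ • x := by
    intro x hx
    simp [hu, hx]
  set τ : EuclideanSpace ℝ (Fin n) → unitInterval :=
    fun x => Set.projIcc 0 1 zero_le_one (2 * ‖x‖ - 1) with hτ
  have hτc : Continuous τ := by
    exact continuous_projIcc.comp (by fun_prop)
  have huc : ∀ x, x ≠ 0 → ContinuousAt u x := by
    intro x hx
    rw [Topology.IsInducing.subtypeVal.continuousAt_iff]
    have : ContinuousAt (fun x : EuclideanSpace ℝ (Fin n) => ‖x‖⁻¹ • x) x :=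
      (continuous_norm.continuousAt.inv₀ (norm_ne_zero_iff.2 hx)).smul continuousAt_id
    refine this.congr ?_
    filter_upwards [isOpen_ne.mem_nhds hx] with y hy
    exact (huv y hy).symm
  set r : EuclideanSpace ℝ (Fin n) → Metric.sphere (0 : EuclideanSpace ℝ (Fin n)) 1 :=
    fun x => H (τ x, u x) with hr
  have hrc : Continuous r := by
    rw [continuous_iff_continuousAt]
    intro x
    by_cases hx : x = 0
    · have : ∀ᶠ y in nhds x, r y = c := by
        rw [hx]
        filter_upwards [Metric.ball_mem_nhds (0 : EuclideanSpace ℝ (Fin n)) (by norm_num : (0:ℝ) < 1/2)] with y hy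
        have hy' : ‖y‖ < 1/2 := by simpa using hy
        have : τ y = 0 := Set.projIcc_of_le_left _ (by linarith)
        simp only [hr, this, h0]
      exact (continuousAt_const (y := c)).congr (this.mono fun y hy => hy.symm)
    · exact H.continuous.continuousAt.comp (hτc.continuousAt.prodMk (huc x hx))
  refine aux_nozero_cont (fun x => (max 1 ‖x‖) • (r x : EuclideanSpace ℝ (Fin n)) - x) ?_ ?_ ?_
  · fun_prop
  · intro x hx
    have hx0 : ‖x‖ ≠ 0 := by linarith
    have : τ x = 1 := Set.projIcc_of_right_le _ (by linarith)
    simp only [hr, this, h1]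
    rw [huv x (norm_ne_zero_iff.1 hx0), max_eq_right hx, smul_inv_smul₀ hx0, sub_self]
  · intro x
    have : ‖(r x : EuclideanSpace ℝ (Fin n))‖ = 1 := by simp
    rw [add_sub_cancel, norm_smul, this, mul_one]
    exact (le_max_left _ _).trans (le_abs_self _)

theorem aux_smul {X : Type*} (f : X → X) (hf : ∀ x, f (f x) = x) (x y : X) :
    (letI := involutionAction f hf
     y ∈ MulAction.orbit (Multiplicative (ZMod 2)) x) ↔ y = x ∨ y = f x := by
  letI := involutionAction f hf
  have hs : ∀ g : Multiplicative (ZMod 2), g • x = if g.toAdd = 1 then f x else x := fun _ => rfl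
  constructor
  · rintro ⟨g, rfl⟩
    simp only [hs]
    split_ifs
    · exact Or.inr rfl
    · exact Or.inl rfl
  · rintro (h | h)
    · exact ⟨1, by simp [h]⟩
    · exact ⟨Multiplicative.ofAdd 1, by simp [hs, h]⟩

theorem aux_sign {n : ℕ} (hn : 1 ≤ n)
    (a b : C(Metric.sphere (0 : EuclideanSpace ℝ (Fin (n + 1))) 1,
      Metric.sphere (0 : EuclideanSpace ℝ (Fin (n + 1))) 1))
    (hab : ∀ x, a x = b x ∨ a x = - b x) : (∀ x, a x = b x) ∨ (∀ x, a x = - b x) := by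
  have hrank : 1 < Module.rank ℝ (EuclideanSpace ℝ (Fin (n + 1))) := by
    rw [← Module.finrank_eq_rank]
    simp only [finrank_euclideanSpace, Fintype.card_fin]
    exact_mod_cast (by omega : 1 < n + 1)
  haveI : PreconnectedSpace (Metric.sphere (0 : EuclideanSpace ℝ (Fin (n + 1))) 1) :=
    Subtype.preconnectedSpace (isPreconnected_sphere hrank 0 1)
  have hA : IsClosed {x | a x = b x} := isClosed_eq a.continuous b.continuous
  have hB : IsClosed {x | a x = - b x} := isClosed_eq a.continuous b.continuous.neg
  have hcompl : {x | a x = b x}ᶜ = {x | a x = - b x} := by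
    ext x
    simp only [Set.mem_compl_iff, Set.mem_ofPred_eq]
    constructor
    · intro h
      exact (hab x).resolve_left h
    · intro h h'
      rw [h'] at h
      exact ne_neg_of_mem_unit_sphere ℝ (b x) h
  have hclopen : IsClopen {x | a x = b x} := ⟨hA, by rw [← isClosed_compl_iff, hcompl]; exact hB⟩
  rcases isClopen_iff.1 hclopen with h | h
  · right
    intro x
    refine (hab x).resolve_left fun hx => ?_
    have : x ∈ {x | a x = b x} := hx
    rw [h] at this
    exact this
  · left
    intro x
    have : x ∈ {x | a x = b x} := by rw [h]; trivial
    exact this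

theorem aux_lower (n : ℕ) (hn : 1 ≤ n) (k : ℕ)
    (hp : @IsEffPlanner (Multiplicative (ZMod 2))
      (Metric.sphere (0 : EuclideanSpace ℝ (Fin (n + 1))) 1) _ _
      (involutionAction
        (fun x : Metric.sphere (0 : EuclideanSpace ℝ (Fin (n + 1))) 1 => -x)
        (fun x => neg_neg x)) (k + 1) k.succ_pos Set.univ) : False := by
  obtain ⟨s, hs, horb, hend⟩ := hp
  obtain ⟨y⟩ : Nonempty (Metric.sphere (0 : EuclideanSpace ℝ (Fin (n + 1))) 1) :=
    (NormedSpace.sphere_nonempty.2 zero_le_one).to_subtype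
  set γ : Metric.sphere (0 : EuclideanSpace ℝ (Fin (n + 1))) 1 → Fin (k + 1) →
    C(unitInterval, Metric.sphere (0 : EuclideanSpace ℝ (Fin (n + 1))) 1) :=
    fun x => s ⟨(x, y), trivial⟩ with hγ
  have hγc : Continuous γ := hs.comp (by fun_prop)
  have hγi : ∀ i, Continuous fun x => γ x i := fun i => (continuous_apply i).comp hγc
  have hγu : ∀ i, Continuous fun p : unitInterval × Metric.sphere (0 : EuclideanSpace ℝ (Fin (n + 1))) 1
      => γ p.2 i p.1 := fun i =>
    ContinuousEval.continuous_eval.comp (((hγi i).comp continuous_snd).prodMk continuous_fst)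
  let e : Fin (k + 1) → unitInterval → C(Metric.sphere (0 : EuclideanSpace ℝ (Fin (n + 1))) 1,
    Metric.sphere (0 : EuclideanSpace ℝ (Fin (n + 1))) 1) :=
    fun i t => ⟨fun x => γ x i t, (hγu i).comp (by fun_prop : Continuous fun x => (t, x))⟩
  let N : C(Metric.sphere (0 : EuclideanSpace ℝ (Fin (n + 1))) 1,
    Metric.sphere (0 : EuclideanSpace ℝ (Fin (n + 1))) 1) := ⟨fun x => -x, continuous_neg⟩
  have hhom : ∀ i, ContinuousMap.Homotopic (e i 0) (e i 1) := fun i =>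
    ⟨{ toFun := fun p => γ p.2 i p.1
       continuous_toFun := hγu i
       map_zero_left := fun x => rfl
       map_one_left := fun x => rfl }⟩
  have hNN : ∀ f : C(Metric.sphere (0 : EuclideanSpace ℝ (Fin (n + 1))) 1,
      Metric.sphere (0 : EuclideanSpace ℝ (Fin (n + 1))) 1), N.comp (N.comp f) = f := fun f => by ext1 x; exact neg_neg _
  have step : ∀ i, ∀ f, (ContinuousMap.Homotopic f (e i 0) ∨ ContinuousMap.Homotopic f (N.comp (e i 0))) →
     (ContinuousMap.Homotopic f (e i 1) ∨ ContinuousMap.Homotopic f (N.comp (e i 1))) := by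
    rintro i f (h | h)
    · exact Or.inl (h.trans (hhom i))
    · exact Or.inr (h.trans ((ContinuousMap.Homotopic.refl N).comp (hhom i)))
  have main : ∀ (i : ℕ) (hi : i < k + 1),
      ContinuousMap.Homotopic (ContinuousMap.id _) (e ⟨i, hi⟩ 1) ∨
      ContinuousMap.Homotopic (ContinuousMap.id _) (N.comp (e ⟨i, hi⟩ 1)) := by
    intro i
    induction i with
    | zero =>
      intro hi
      apply step
      left
      have : e ⟨0, hi⟩ 0 = ContinuousMap.id _ := by
        ext1 x
        exact (hend ⟨(x, y), trivial⟩).1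
      rw [this]
    | succ i ih =>
      intro hi
      apply step
      have ih' := ih (by omega)
      have hor : ∀ x, e ⟨i + 1, hi⟩ 0 x = e ⟨i, by omega⟩ 1 x ∨ e ⟨i + 1, hi⟩ 0 x = - e ⟨i, by omega⟩ 1 x := by
        intro x
        exact (aux_smul _ _ _ _).1 (horb ⟨(x, y), trivial⟩ i hi)
      rcases aux_sign hn _ _ hor with h | h
      · have : e ⟨i + 1, hi⟩ 0 = e ⟨i, by omega⟩ 1 := by ext1 x; exact h x
        rw [this]
        exact ih'
      · have : e ⟨i + 1, hi⟩ 0 = N.comp (e ⟨i, by omega⟩ 1) := by ext1 x; exact h x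
        rw [this, hNN]
        exact ih'.symm
  have hfin : ∃ c, ContinuousMap.Homotopic (ContinuousMap.const _ c) (ContinuousMap.id
      (Metric.sphere (0 : EuclideanSpace ℝ (Fin (n + 1))) 1)) := by
    have hy : ∀ x, e ⟨k, by omega⟩ 1 x = y := fun x => (hend ⟨(x, y), trivial⟩).2
    rcases main k (by omega) with h | h
    · refine ⟨y, ?_⟩
      have : e ⟨k, by omega⟩ 1 = ContinuousMap.const _ y := by ext1 x; exact hy x
      rw [← this]
      exact h.symm
    · refine ⟨-y, ?_⟩
      have : N.comp (e ⟨k, by omega⟩ 1) = ContinuousMap.const _ (-y) := by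
        ext1 x
        exact congrArg Neg.neg (hy x)
      rw [← this]
      exact h.symm
  obtain ⟨c, ⟨H⟩⟩ := hfin
  exact aux_not_contractible H.toContinuousMap c (fun x => H.map_zero_left x)
    (fun x => H.map_one_left x)

theorem aux_geo {n : ℕ} {U : Type*} [TopologicalSpace U]
    (a b : U → Metric.sphere (0 : EuclideanSpace ℝ (Fin n)) 1)
    (ha : Continuous a) (hb : Continuous b) (hab : ∀ u, a u ≠ - b u) :
    ∃ s : U → C(unitInterval, Metric.sphere (0 : EuclideanSpace ℝ (Fin n)) 1),
      Continuous s ∧ ∀ u, s u 0 = a u ∧ s u 1 = b u := by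
  let w : U × unitInterval → EuclideanSpace ℝ (Fin n) := fun p =>
    (1 - (p.2 : ℝ)) • (a p.1 : EuclideanSpace ℝ (Fin n)) + (p.2 : ℝ) • (b p.1 : EuclideanSpace ℝ (Fin n))
  have hw : Continuous w := by fun_prop
  have hw0 : ∀ p, w p ≠ 0 := by
    rintro ⟨u, t⟩ h
    have h1 : (1 - (t : ℝ)) • (a u : EuclideanSpace ℝ (Fin n)) = -((t : ℝ) • (b u : EuclideanSpace ℝ (Fin n))) :=
      eq_neg_of_add_eq_zero_left h
    have h2 := congrArg norm h1
    rw [norm_neg, norm_smul, norm_smul, Real.norm_of_nonneg t.2.1,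
      Real.norm_of_nonneg (sub_nonneg.2 t.2.2)] at h2
    simp only [norm_eq_of_mem_sphere, mul_one] at h2
    have ht : (t : ℝ) = 1 / 2 := by linarith
    rw [ht, ← smul_neg] at h1
    have h3 : (1 - 1 / 2 : ℝ) = 1 / 2 := by norm_num
    rw [h3] at h1
    exact hab u (Subtype.ext (smul_right_injective _ (by norm_num : (1 / 2 : ℝ) ≠ 0) h1))
  let q : C(U × unitInterval, Metric.sphere (0 : EuclideanSpace ℝ (Fin n)) 1) :=
    ⟨fun p => ⟨‖w p‖⁻¹ • w p, by simp [norm_smul, norm_ne_zero_iff.2 (hw0 p)]⟩, by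
      refine Continuous.subtype_mk ?_ _
      exact (hw.norm.inv₀ (fun p => norm_ne_zero_iff.2 (hw0 p))).smul hw⟩
  refine ⟨q.curry, q.curry.continuous, fun u => ⟨?_, ?_⟩⟩
  · apply Subtype.ext
    show ‖w (u, 0)‖⁻¹ • w (u, 0) = a u
    have : w (u, 0) = a u := by simp [w]
    rw [this]; simp
  · apply Subtype.ext
    show ‖w (u, 1)‖⁻¹ • w (u, 1) = b u
    have : w (u, 1) = b u := by simp [w]
    rw [this]; simp

theorem aux_planner (n : ℕ) (U : Set (Metric.sphere (0 : EuclideanSpace ℝ (Fin (n + 1))) 1 ×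
      Metric.sphere (0 : EuclideanSpace ℝ (Fin (n + 1))) 1))
    (b : U → Metric.sphere (0 : EuclideanSpace ℝ (Fin (n + 1))) 1) (hb : Continuous b)
    (hb1 : ∀ u : U, u.1.2 = b u ∨ u.1.2 = - b u) (hb2 : ∀ u : U, u.1.1 ≠ - b u) :
    @IsEffPlanner (Multiplicative (ZMod 2))
      (Metric.sphere (0 : EuclideanSpace ℝ (Fin (n + 1))) 1) _ _
      (involutionAction
        (fun x : Metric.sphere (0 : EuclideanSpace ℝ (Fin (n + 1))) 1 => -x)
        (fun x => neg_neg x)) (1 + 1) (Nat.succ_pos 1) U := by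
  obtain ⟨s, hs, hse⟩ := aux_geo (fun u : U => u.1.1) b (by fun_prop) hb hb2
  refine ⟨fun u => ![s u, ContinuousMap.const _ u.1.2], ?_, ?_, ?_⟩
  · refine continuous_pi fun i => ?_
    fin_cases i
    · exact hs
    · exact ContinuousMap.continuous_const'.comp (by fun_prop : Continuous fun u : U => u.1.2)
  · intro u i hi
    obtain rfl : i = 0 := by omega
    refine (aux_smul _ _ _ _).2 ?_
    show u.1.2 = s u 1 ∨ u.1.2 = - s u 1
    rw [(hse u).2]
    exact hb1 u
  · intro u
    exact ⟨(hse u).1, rfl⟩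

/-- For the antipodal `ℤ/2`-action `x ↦ -x` on `S^n ⊆ ℝ^{n+1}` (`n ≥ 1`),
the effective topological complexity is `TC^{ℤ/2,∞}(S^n) = 2`. -/
theorem effTCinf_antipodal_sphere (n : ℕ) (hn : 1 ≤ n) :
    @effTCinf (Multiplicative (ZMod 2))
      (Metric.sphere (0 : EuclideanSpace ℝ (Fin (n + 1))) 1) _ _
      (involutionAction
        (fun x : Metric.sphere (0 : EuclideanSpace ℝ (Fin (n + 1))) 1 => -x)
        (fun x => neg_neg x)) = 2 := by
  apply le_antisymm
  · refine (iInf_le _ 1).trans (sInf_le ⟨2, rfl, by norm_num, ?_⟩)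
    refine ⟨![{p | p.1 ≠ - p.2}, {p | p.1 ≠ p.2}], ?_, ?_, ?_⟩
    · intro i
      fin_cases i
      · exact isOpen_ne_fun continuous_fst continuous_snd.neg
      · exact isOpen_ne_fun continuous_fst continuous_snd
    · rw [Set.eq_univ_iff_forall]
      rintro ⟨x, y⟩
      rw [Set.mem_iUnion]
      by_cases h : x = y
      · refine ⟨0, ?_⟩
        show x ≠ - y
        rw [h]
        intro h'
        exact ne_neg_of_mem_unit_sphere ℝ y h'
      · exact ⟨1, h⟩
    · intro i
      fin_cases i
      · exact aux_planner n _ (fun u => u.1.2) (by fun_prop) (fun u => Or.inl rfl) (fun u => u.2)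
      · refine aux_planner n _ (fun u => - u.1.2) (by fun_prop)
          (fun u => Or.inr (neg_neg _).symm) (fun u => ?_)
        rw [neg_neg]
        exact u.2
  · refine le_iInf fun k => le_sInf ?_
    rintro ℓ ⟨m, rfl, hm, U, -, hU, hpl⟩
    by_contra hlt
    have hm1 : m = 1 := by
      have : (m : ℕ∞) < (2 : ℕ) := not_le.1 hlt
      have := ENat.natCast_lt_natCast.1 this
      omega
    subst hm1
    have h0 : U 0 = Set.univ := by
      rw [← hU]
      ext p
      simp
    have := hpl 0
    rw [h0] at this
    exact aux_lower n hn k this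
end
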